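/- arXiv:1511.07798 — 2 statements merged into one kernel-verified Lean document; each statement's English description precedes it below -/
import Mathlib

section
/- Let n ≥ 3. Every finite index subgroup of SL(n,ℤ) contains a finite index subgroup generated by two elements. -/
section Transvections

open Matrix

variable {ι : Type*} [Fintype ι] [DecidableEq ι]

/-- The transvection `1 + x yᵀ` attached to a column `x` and a row `y` with `y x = 0`. -/
def rankOneTransvection (x y : ι → ℤ) (h : y ⬝ᵥ x = 0) : Matrix.SpecialLinearGroup ι ℤ :=
  ⟨1 + vecMulVec x y, by
    rw [vecMulVec_eq Unit, det_one_add_replicateCol_mul_replicateRow, h, add_zero]⟩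

theorem coe_rankOneTransvection (x y : ι → ℤ) (h : y ⬝ᵥ x = 0) :
    (rankOneTransvection x y h : Matrix ι ι ℤ) = 1 + vecMulVec x y := rfl

theorem coe_inv_mul_coe (g : Matrix.SpecialLinearGroup ι ℤ) :
    ((g⁻¹ : Matrix.SpecialLinearGroup ι ℤ) : Matrix ι ι ℤ) * g = 1 := by
  rw [← Matrix.SpecialLinearGroup.coe_mul, inv_mul_cancel, Matrix.SpecialLinearGroup.coe_one]

theorem inv_rankOneTransvection {x y : ι → ℤ} (h : y ⬝ᵥ x = 0) :
    (rankOneTransvection x y h)⁻¹ =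
      rankOneTransvection (-x) y (by rw [dotProduct_neg, h, neg_zero]) := by
  rw [inv_eq_iff_mul_eq_one]
  apply Subtype.ext
  rw [Matrix.SpecialLinearGroup.coe_mul, coe_rankOneTransvection, coe_rankOneTransvection, mul_add,
    add_mul, add_mul, vecMulVec_mul_vecMulVec, dotProduct_neg, h, neg_vecMulVec]
  simp

theorem rankOneTransvection_mul_of_left {x x' y : ι → ℤ} (h : y ⬝ᵥ x = 0) (h' : y ⬝ᵥ x' = 0) :
    rankOneTransvection x y h * rankOneTransvection x' y h' =
      rankOneTransvection (x + x') y (by rw [dotProduct_add, h, h', add_zero]) := by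
  apply Subtype.ext
  simp [coe_rankOneTransvection, mul_add, add_mul, vecMulVec_mul_vecMulVec, h', add_vecMulVec,
    add_assoc]

theorem rankOneTransvection_mul_of_right {x y y' : ι → ℤ} (h : y ⬝ᵥ x = 0) (h' : y' ⬝ᵥ x = 0) :
    rankOneTransvection x y h * rankOneTransvection x y' h' =
      rankOneTransvection x (y + y') (by rw [add_dotProduct, h, h', add_zero]) := by
  apply Subtype.ext
  simp [coe_rankOneTransvection, mul_add, add_mul, vecMulVec_mul_vecMulVec, h, vecMulVec_add,
    add_assoc]

theorem dotProduct_vecMul_inv_mulVec (g : Matrix.SpecialLinearGroup ι ℤ) (x y : ι → ℤ) :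
    (y ᵥ* ((g⁻¹ : Matrix.SpecialLinearGroup ι ℤ) : Matrix ι ι ℤ)) ⬝ᵥ ((g : Matrix ι ι ℤ) *ᵥ x) =
      y ⬝ᵥ x := by
  rw [dotProduct_mulVec, vecMul_vecMul, coe_inv_mul_coe, vecMul_one]

theorem conj_rankOneTransvection (g : Matrix.SpecialLinearGroup ι ℤ) {x y : ι → ℤ}
    (h : y ⬝ᵥ x = 0) : g * rankOneTransvection x y h * g⁻¹ =
      rankOneTransvection ((g : Matrix ι ι ℤ) *ᵥ x)
        (y ᵥ* ((g⁻¹ : Matrix.SpecialLinearGroup ι ℤ) : Matrix ι ι ℤ))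
        (by rw [dotProduct_vecMul_inv_mulVec, h]) := by
  apply Subtype.ext
  have e : (g : Matrix ι ι ℤ) * (g⁻¹ : Matrix.SpecialLinearGroup ι ℤ) = 1 := by
    rw [← Matrix.SpecialLinearGroup.coe_mul, mul_inv_cancel, Matrix.SpecialLinearGroup.coe_one]
  rw [Matrix.SpecialLinearGroup.coe_mul, Matrix.SpecialLinearGroup.coe_mul,
    coe_rankOneTransvection, coe_rankOneTransvection, mul_add, add_mul, mul_one, e,
    mul_vecMulVec, vecMulVec_mul]

theorem rankOneTransvection_commutator {x y z z' : ι → ℤ} (h : z ⬝ᵥ x = 0) (h' : y ⬝ᵥ z' = 0)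
    (hyx : y ⬝ᵥ x = 0) :
    rankOneTransvection x z h * rankOneTransvection z' y h' * (rankOneTransvection x z h)⁻¹ *
        (rankOneTransvection z' y h')⁻¹ =
      rankOneTransvection ((z ⬝ᵥ z') • x) y (by rw [dotProduct_smul, hyx, smul_zero]) := by
  apply Subtype.ext
  rw [inv_rankOneTransvection, inv_rankOneTransvection, mul_assoc]
  simp only [Matrix.SpecialLinearGroup.coe_mul, coe_rankOneTransvection, mul_add, add_mul,
    neg_vecMulVec, mul_neg, neg_mul, vecMulVec_mul_vecMulVec, h, h', hyx, mul_one, one_mul,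
    vecMulVec_smul, smul_vecMulVec, zero_smul, vecMulVec_zero, smul_zero,
    smul_mul_assoc, mul_smul_comm]
  module

/-- The subgroup `H` contains the transvection `1 + x yᵀ`. -/
def HasTransvection (H : Subgroup (Matrix.SpecialLinearGroup ι ℤ)) (x y : ι → ℤ) : Prop :=
  ∃ h : y ⬝ᵥ x = 0, rankOneTransvection x y h ∈ H

namespace HasTransvection

variable {H : Subgroup (Matrix.SpecialLinearGroup ι ℤ)} {x x' y y' z z' : ι → ℤ}

theorem of_coe_eq {g : Matrix.SpecialLinearGroup ι ℤ} (hg : g ∈ H) (h : y ⬝ᵥ x = 0)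
    (e : (g : Matrix ι ι ℤ) = 1 + vecMulVec x y) : HasTransvection H x y :=
  ⟨h, by rwa [show rankOneTransvection x y h = g from Subtype.ext e.symm]⟩

theorem congr (h : HasTransvection H x y) (h0 : y' ⬝ᵥ x' = 0)
    (e : vecMulVec x y = vecMulVec x' y') : HasTransvection H x' y' := by
  obtain ⟨h, hm⟩ := h
  exact of_coe_eq hm h0 (by rw [coe_rankOneTransvection, e])

theorem zero_right (H : Subgroup (Matrix.SpecialLinearGroup ι ℤ)) (x : ι → ℤ) :
    HasTransvection H x 0 :=
  of_coe_eq H.one_mem (by simp) (by simp)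

theorem zero_left (H : Subgroup (Matrix.SpecialLinearGroup ι ℤ)) (y : ι → ℤ) :
    HasTransvection H 0 y :=
  of_coe_eq H.one_mem (by simp) (by simp)

theorem add_left (h : HasTransvection H x y) (h' : HasTransvection H x' y) :
    HasTransvection H (x + x') y :=
  ⟨_, rankOneTransvection_mul_of_left h.1 h'.1 ▸ H.mul_mem h.2 h'.2⟩

theorem add_right (h : HasTransvection H x y) (h' : HasTransvection H x y') :
    HasTransvection H x (y + y') :=
  ⟨_, rankOneTransvection_mul_of_right h.1 h'.1 ▸ H.mul_mem h.2 h'.2⟩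

theorem neg_left (h : HasTransvection H x y) : HasTransvection H (-x) y := by
  obtain ⟨h, hm⟩ := h
  exact ⟨_, inv_rankOneTransvection h ▸ H.inv_mem hm⟩

/-- The columns `x` such that `H` contains `1 + x yᵀ`, as an additive group. -/
def columns (H : Subgroup (Matrix.SpecialLinearGroup ι ℤ)) (y : ι → ℤ) : AddSubgroup (ι → ℤ) where
  carrier := {x | HasTransvection H x y}
  add_mem' := add_left
  zero_mem' := zero_left H y
  neg_mem' := neg_left

theorem smul_left (c : ℤ) (h : HasTransvection H x y) : HasTransvection H (c • x) y :=
  (columns H y).zsmul_mem h c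

theorem sum_left {α : Type*} (s : Finset α) (f : α → ι → ℤ)
    (h : ∀ a ∈ s, HasTransvection H (f a) y) : HasTransvection H (∑ a ∈ s, f a) y :=
  (columns H y).sum_mem h

theorem smul_right_of_smul_left {c : ℤ} (hy : y ⬝ᵥ x = 0) (h : HasTransvection H (c • x) y) :
    HasTransvection H x (c • y) :=
  h.congr (by rw [smul_dotProduct, hy, smul_zero]) (by rw [smul_vecMulVec, vecMulVec_smul])

theorem smul_left_of_smul_right {c : ℤ} (hy : y ⬝ᵥ x = 0) (h : HasTransvection H x (c • y)) :
    HasTransvection H (c • x) y :=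
  h.congr (by rw [dotProduct_smul, hy, smul_zero]) (by rw [smul_vecMulVec, vecMulVec_smul])

theorem smul_right (c : ℤ) (h : HasTransvection H x y) : HasTransvection H x (c • y) :=
  smul_right_of_smul_left h.1 (h.smul_left c)

theorem sum_right {α : Type*} (s : Finset α) (f : α → ι → ℤ)
    (h : ∀ a ∈ s, HasTransvection H x (f a)) : HasTransvection H x (∑ a ∈ s, f a) := by
  classical
  induction s using Finset.induction_on with
  | empty => exact zero_right H x
  | insert a s ha ih =>
    rw [Finset.sum_insert ha]
    exact (h a (by simp)).add_right (ih fun b hb => h b (by simp [hb]))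

theorem commutator (h : HasTransvection H x z) (h' : HasTransvection H z' y) (hyx : y ⬝ᵥ x = 0) :
    HasTransvection H ((z ⬝ᵥ z') • x) y :=
  ⟨_, rankOneTransvection_commutator h.1 h'.1 hyx ▸
    H.mul_mem (H.mul_mem (H.mul_mem h.2 h'.2) (H.inv_mem h.2)) (H.inv_mem h'.2)⟩

theorem conj {g : Matrix.SpecialLinearGroup ι ℤ} (h : HasTransvection H x y)
    (hg : ∀ k ∈ H, g * k * g⁻¹ ∈ H) :
    HasTransvection H ((g : Matrix ι ι ℤ) *ᵥ x)
      (y ᵥ* ((g⁻¹ : Matrix.SpecialLinearGroup ι ℤ) : Matrix ι ι ℤ)) := by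
  exact ⟨_, conj_rankOneTransvection g h.1 ▸ hg _ h.2⟩

end HasTransvection

theorem mulVec_rankOneTransvection (x y v : ι → ℤ) (h : y ⬝ᵥ x = 0) :
    (rankOneTransvection x y h : Matrix ι ι ℤ) *ᵥ v = v + (y ⬝ᵥ v) • x := by
  rw [coe_rankOneTransvection, add_mulVec, one_mulVec, vecMulVec_mulVec, op_smul_eq_smul]

/-- The subgroup generated by the elementary matrices with both indices in `s`. -/
def elementarySubgroup (s : Set ι) : Subgroup (Matrix.SpecialLinearGroup ι ℤ) :=
  Subgroup.closure {g | ∃ i ∈ s, ∃ j ∈ s, ∃ (hij : i ≠ j) (a : ℤ),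
    g = rankOneTransvection (Pi.single i a) (Pi.single j 1) (by simp [hij])}

theorem hasTransvection_elementarySubgroup {s : Set ι} {i j : ι} (hi : i ∈ s) (hj : j ∈ s)
    (hij : i ≠ j) (a : ℤ) :
    HasTransvection (elementarySubgroup s) (Pi.single i a) (Pi.single j 1) :=
  ⟨_, Subgroup.subset_closure ⟨i, hi, j, hj, hij, a, rfl⟩⟩

theorem elementarySubgroup_mono {s t : Set ι} (h : s ⊆ t) :
    elementarySubgroup s ≤ elementarySubgroup t := by
  refine Subgroup.closure_mono ?_
  rintro g ⟨i, hi, j, hj, hij, a, rfl⟩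
  exact ⟨i, h hi, j, h hj, hij, a, rfl⟩

theorem elementarySubgroup_le {s : Set ι} {H : Subgroup (Matrix.SpecialLinearGroup ι ℤ)}
    (h : ∀ i ∈ s, ∀ j ∈ s, i ≠ j → ∀ a, HasTransvection H (Pi.single i a) (Pi.single j 1)) :
    elementarySubgroup s ≤ H := by
  refine (Subgroup.closure_le H).2 ?_
  rintro g ⟨i, hi, j, hj, hij, a, rfl⟩
  exact (h i hi j hj hij a).2

theorem mulVec_single_of_mem_elementarySubgroup {s : Set ι} {l : ι} (hl : l ∉ s)
    {g : Matrix.SpecialLinearGroup ι ℤ} (hg : g ∈ elementarySubgroup s) :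
    (g : Matrix ι ι ℤ) *ᵥ Pi.single l 1 = Pi.single l 1 := by
  induction hg using Subgroup.closure_induction with
  | mem g hg =>
    obtain ⟨i, hi, j, hj, hij, a, rfl⟩ := hg
    have : l ≠ j := fun h => hl (h ▸ hj)
    rw [mulVec_rankOneTransvection]
    simp [this]
  | one => rw [Matrix.SpecialLinearGroup.coe_one, one_mulVec]
  | mul a b _ _ ha hb => rw [Matrix.SpecialLinearGroup.coe_mul, ← mulVec_mulVec, hb, ha]
  | inv a _ ha =>
    conv_lhs => rw [← ha]
    rw [mulVec_mulVec, coe_inv_mul_coe, one_mulVec]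

theorem exists_elementary_add {s : Set ι} {i j : ι} (hi : i ∈ s) (hj : j ∈ s) (hij : i ≠ j)
    (a : ℤ) (v : ι → ℤ) : ∃ h ∈ elementarySubgroup s,
      (h : Matrix ι ι ℤ) *ᵥ v = v + Pi.single i (a * v j) := by
  obtain ⟨h0, h⟩ := hasTransvection_elementarySubgroup hi hj hij a
  refine ⟨_, h, ?_⟩
  rw [mulVec_rankOneTransvection]
  simp [← Pi.single_smul, mul_comm]

theorem exists_elementary_rotate {s : Set ι} {i j : ι} (hi : i ∈ s) (hj : j ∈ s) (hij : i ≠ j)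
    (v : ι → ℤ) : ∃ h ∈ elementarySubgroup s, ((h : Matrix ι ι ℤ) *ᵥ v) i = v j ∧
      ((h : Matrix ι ι ℤ) *ᵥ v) j = - v i ∧
      ∀ k, k ≠ i → k ≠ j → ((h : Matrix ι ι ℤ) *ᵥ v) k = v k := by
  obtain ⟨a, ha, ea⟩ := exists_elementary_add hi hj hij 1 v
  obtain ⟨b, hb, eb⟩ := exists_elementary_add hj hi hij.symm (-1) ((a : Matrix ι ι ℤ) *ᵥ v)
  obtain ⟨c, hc, ec⟩ := exists_elementary_add hi hj hij 1
    ((b : Matrix ι ι ℤ) *ᵥ (a : Matrix ι ι ℤ) *ᵥ v)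
  refine ⟨c * (b * a), mul_mem hc (mul_mem hb ha), ?_⟩
  rw [Matrix.SpecialLinearGroup.coe_mul, Matrix.SpecialLinearGroup.coe_mul, ← mulVec_mulVec,
    ← mulVec_mulVec, ec, eb, ea]
  refine ⟨?_, ?_, fun k hk hk' => ?_⟩
  · simp [hij.symm]
  · simp [hij.symm]
  · simp [hk, hk']

/-- The Euclidean algorithm on two coordinates, with nonnegative outcome. -/
theorem exists_elementary_gcd {s : Set ι} {i j : ι} (hi : i ∈ s) (hj : j ∈ s) (hij : i ≠ j)
    (v : ι → ℤ) : ∃ h ∈ elementarySubgroup s, 0 ≤ ((h : Matrix ι ι ℤ) *ᵥ v) i ∧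
      ((h : Matrix ι ι ℤ) *ᵥ v) j = 0 ∧
      ∀ k, k ≠ i → k ≠ j → ((h : Matrix ι ι ℤ) *ᵥ v) k = v k := by
  induction hm : (v j).natAbs using Nat.strong_induction_on generalizing v with
  | _ m ih =>
    by_cases h0 : v j = 0
    · by_cases hp : 0 ≤ v i
      · exact ⟨1, one_mem _, by simpa using hp, by simpa using h0, by simp⟩
      · obtain ⟨a, ha, ai, aj, ak⟩ := exists_elementary_rotate hi hj hij v
        obtain ⟨b, hb, bi, bj, bk⟩ := exists_elementary_rotate hi hj hij ((a : Matrix ι ι ℤ) *ᵥ v)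
        refine ⟨b * a, mul_mem hb ha, ?_⟩
        rw [Matrix.SpecialLinearGroup.coe_mul, ← mulVec_mulVec]
        refine ⟨?_, ?_, fun k hk hk' => ?_⟩
        · rw [bi, aj]; lia
        · rw [bj, ai, h0, neg_zero]
        · rw [bk k hk hk', ak k hk hk']
    · obtain ⟨a, ha, ea⟩ := exists_elementary_add hi hj hij (-(v i / v j)) v
      obtain ⟨b, hb, bi, bj, bk⟩ := exists_elementary_rotate hi hj hij ((a : Matrix ι ι ℤ) *ᵥ v)
      have e : ((b : Matrix ι ι ℤ) *ᵥ (a : Matrix ι ι ℤ) *ᵥ v) j = -(v i % v j) := by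
        rw [bj, ea, Int.emod_def]
        simp
        ring
      have hlt : (((b : Matrix ι ι ℤ) *ᵥ (a : Matrix ι ι ℤ) *ᵥ v) j).natAbs < m := by
        have h1 := Int.emod_nonneg (v i) h0
        have h2 := Int.emod_lt_abs (v i) h0
        rw [Int.abs_eq_natAbs] at h2
        rw [e]
        lia
      obtain ⟨c, hc, ci, cj, ck⟩ := ih _ hlt _ rfl
      refine ⟨c * (b * a), mul_mem hc (mul_mem hb ha), ?_⟩
      rw [Matrix.SpecialLinearGroup.coe_mul, Matrix.SpecialLinearGroup.coe_mul, ← mulVec_mulVec,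
        ← mulVec_mulVec]
      refine ⟨ci, cj, fun k hk hk' => ?_⟩
      rw [ck k hk hk', bk k hk hk', ea]
      simp [hk]

theorem exists_elementary_gcd_finset {s : Set ι} {i : ι} (hi : i ∈ s) (t : Finset ι)
    (ht : ↑t ⊆ s) (hit : i ∉ t) (v : ι → ℤ) : ∃ h ∈ elementarySubgroup s,
      (t.Nonempty → 0 ≤ ((h : Matrix ι ι ℤ) *ᵥ v) i) ∧
      (∀ j ∈ t, ((h : Matrix ι ι ℤ) *ᵥ v) j = 0) ∧
      ∀ k, k ≠ i → k ∉ t → ((h : Matrix ι ι ℤ) *ᵥ v) k = v k := by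
  induction t using Finset.induction_on with
  | empty => exact ⟨1, one_mem _, by simp⟩
  | insert j t hj ih =>
    rw [Finset.coe_insert, Set.insert_subset_iff] at ht
    rw [Finset.mem_insert, not_or] at hit
    obtain ⟨a, ha, -, a0, ak⟩ := ih ht.2 hit.2
    obtain ⟨b, hb, bi, bj, bk⟩ := exists_elementary_gcd hi ht.1 hit.1 ((a : Matrix ι ι ℤ) *ᵥ v)
    refine ⟨b * a, mul_mem hb ha, ?_⟩
    rw [Matrix.SpecialLinearGroup.coe_mul, ← mulVec_mulVec]
    refine ⟨fun _ => bi, fun k hk => ?_, fun k hk hk' => ?_⟩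
    · by_cases hkj : k = j
      · rw [hkj, bj]
      · have hkt := Finset.mem_of_mem_insert_of_ne hk hkj
        rw [bk k (fun h => hit.2 (h ▸ hkt)) hkj, a0 k hkt]
    · rw [Finset.mem_insert, not_or] at hk'
      rw [bk k hk hk'.1, ak k hk hk'.2]

theorem eq_sum_single (x : ι → ℤ) : x = ∑ i, Pi.single i (x i) :=
  (Finset.univ_sum_single x).symm

theorem hasTransvection_left_of_single {H : Subgroup (Matrix.SpecialLinearGroup ι ℤ)} {j : ι}
    {q : ℤ} (h : ∀ i, i ≠ j → HasTransvection H (Pi.single i q) (Pi.single j 1))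
    {x : ι → ℤ} (hx : x j = 0) : HasTransvection H (q • x) (Pi.single j 1) := by
  rw [eq_sum_single (q • x)]
  refine HasTransvection.sum_left _ _ fun i _ => ?_
  by_cases hij : i = j
  · subst hij
    simpa [hx] using HasTransvection.zero_left H _
  · have := (h i hij).smul_left (x i)
    rw [← Pi.single_smul] at this
    simpa [mul_comm] using this

theorem rankOneTransvection_of_fixes {g : Matrix.SpecialLinearGroup ι ℤ} {k : ι}
    (hg : ∀ j, j ≠ k → (g : Matrix ι ι ℤ) *ᵥ Pi.single j 1 = Pi.single j 1) :
    ∃ x : ι → ℤ, x k = 0 ∧ (g : Matrix ι ι ℤ) = 1 + vecMulVec x (Pi.single k 1) := by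
  set x : ι → ℤ := (g : Matrix ι ι ℤ) *ᵥ Pi.single k 1 - Pi.single k 1 with hx
  have e : (g : Matrix ι ι ℤ) = 1 + vecMulVec x (Pi.single k 1) := by
    refine Matrix.ext_of_mulVec_single fun j => ?_
    rw [add_mulVec, one_mulVec, vecMulVec_mulVec, op_smul_eq_smul]
    by_cases hj : j = k
    · subst hj
      simp [hx]
    · simp [hg j hj, Ne.symm hj]
  refine ⟨x, ?_, e⟩
  have := g.2
  rw [e, vecMulVec_eq Unit, det_one_add_replicateCol_mul_replicateRow] at this
  simpa using this

theorem exists_elementary_fixes (t : Finset ι) (ht : tᶜ.Nonempty)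
    (g : Matrix.SpecialLinearGroup ι ℤ) : ∃ h ∈ elementarySubgroup (Set.univ : Set ι), ∀ j ∈ t,
      ((h * g : Matrix.SpecialLinearGroup ι ℤ) : Matrix ι ι ℤ) *ᵥ Pi.single j 1 =
        Pi.single j 1 := by
  induction t using Finset.induction_on with
  | empty => exact ⟨1, one_mem _, by simp⟩
  | insert k t hk ih =>
    obtain ⟨a, ha, hat⟩ := ih (ht.mono (Finset.compl_subset_compl.2 (Finset.subset_insert k t)))
    set g₁ := a * g with hg₁
    obtain ⟨b, hb, bk, b0, -⟩ := exists_elementary_gcd_finset (s := (↑(tᶜ) : Set ι)) (i := k)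
      (by simpa using hk) (insert k t)ᶜ (by intro x; simp; tauto) (by simp)
      ((g₁ : Matrix ι ι ℤ) *ᵥ Pi.single k 1)
    replace bk := bk ht
    set g₂ := b * g₁ with hg₂
    rw [mulVec_mulVec, ← Matrix.SpecialLinearGroup.coe_mul, ← hg₂] at bk b0
    have hfix : ∀ j ∈ t, (g₂ : Matrix ι ι ℤ) *ᵥ Pi.single j 1 = Pi.single j 1 := fun j hj => by
      rw [hg₂, Matrix.SpecialLinearGroup.coe_mul, ← mulVec_mulVec, hat j hj,
        mulVec_single_of_mem_elementarySubgroup (by simpa using hj) hb]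
    set v := (g₂ : Matrix ι ι ℤ) *ᵥ Pi.single k 1 with hv
    set y : ι → ℤ := Pi.single k 1 ᵥ* ((g₂⁻¹ : Matrix.SpecialLinearGroup ι ℤ) : Matrix ι ι ℤ)
      with hy
    have hyg : ∀ j, y ⬝ᵥ ((g₂ : Matrix ι ι ℤ) *ᵥ Pi.single j 1) =
        (Pi.single k 1 : ι → ℤ) ⬝ᵥ Pi.single j 1 := fun j => by
      rw [hy, dotProduct_mulVec, vecMul_vecMul, coe_inv_mul_coe, vecMul_one]
    have hy0 : ∀ j ∈ t, y j = 0 := fun j hj => by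
      have := hyg j
      rw [hfix j hj] at this
      have hjk : k ≠ j := fun h => hk (h ▸ hj)
      simpa [hjk] using this
    have hyv : y ⬝ᵥ v = y k * v k := by
      refine Finset.sum_eq_single k (fun j _ hjk => ?_) (by simp)
      by_cases hj : j ∈ t
      · rw [hy0 j hj, zero_mul]
      · rw [b0 j (by simp [hjk, hj]), mul_zero]
    have hvk : v k = 1 := by
      have h1 : y k * v k = 1 := by rw [← hyv, hv, hyg k]; simp
      exact Int.eq_one_of_dvd_one bk ⟨y k, by rw [mul_comm, h1]⟩
    obtain ⟨hx, hm⟩ := hasTransvection_left_of_single (q := 1) (j := k)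
      (fun i hi => hasTransvection_elementarySubgroup (Set.mem_univ i) (Set.mem_univ k) hi 1)
      (x := Pi.single k 1 - v) (by simp [hvk])
    refine ⟨rankOneTransvection _ _ hx * (b * a), mul_mem hm
      (mul_mem (elementarySubgroup_mono (Set.subset_univ _) hb) ha), fun j hj => ?_⟩
    rw [mul_assoc, mul_assoc, ← hg₁, ← hg₂, Matrix.SpecialLinearGroup.coe_mul, ← mulVec_mulVec,
      mulVec_rankOneTransvection]
    rcases Finset.mem_insert.1 hj with rfl | hj
    · rw [← hv]; simp [hvk]
    · have hjk : j ≠ k := fun h => hk (h ▸ hj)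
      rw [hfix j hj]
      simp [hjk.symm]

theorem elementarySubgroup_univ : elementarySubgroup (Set.univ : Set ι) = ⊤ := by
  refine (Subgroup.eq_top_iff' _).2 fun g => ?_
  rcases isEmpty_or_nonempty ι with hι | ⟨⟨k⟩⟩
  · rw [Subsingleton.elim g 1]
    exact one_mem _
  obtain ⟨h, hh, hg⟩ := exists_elementary_fixes ({k}ᶜ : Finset ι) (by simp) g
  obtain ⟨x, hxk, e⟩ := rankOneTransvection_of_fixes (g := h * g) (k := k) (by simpa using hg)
  obtain ⟨hx, hm⟩ := hasTransvection_left_of_single (q := 1) (j := k)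
      (fun i hi => hasTransvection_elementarySubgroup (Set.mem_univ i) (Set.mem_univ k) hi 1) hxk
  have : h * g = rankOneTransvection _ _ hx := Subtype.ext (by
    rw [e, coe_rankOneTransvection, one_smul])
  rw [← this] at hm
  exact (Subgroup.mul_mem_cancel_left _ hh).1 hm
theorem hasTransvection_right_of_single {H : Subgroup (Matrix.SpecialLinearGroup ι ℤ)} {i : ι}
    {q : ℤ} (h : ∀ j, i ≠ j → HasTransvection H (Pi.single i q) (Pi.single j 1))
    {y : ι → ℤ} (hy : y i = 0) : HasTransvection H (Pi.single i q) y := by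
  rw [eq_sum_single y]
  refine HasTransvection.sum_right _ _ fun j _ => ?_
  by_cases hij : i = j
  · subst hij
    rw [hy, Pi.single_zero]
    exact HasTransvection.zero_right H _
  · have := (h j hij).smul_right (y j)
    rw [← Pi.single_smul] at this
    simpa using this

/-- The principal congruence subgroup of level `q`. -/
def congruenceSubgroup (ι : Type*) [Fintype ι] [DecidableEq ι] (q : ℕ) :
    Subgroup (Matrix.SpecialLinearGroup ι ℤ) :=
  (Matrix.SpecialLinearGroup.map (Int.castRingHom (ZMod q))).ker

theorem mem_congruenceSubgroup_iff {q : ℕ} {g : Matrix.SpecialLinearGroup ι ℤ} :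
    g ∈ congruenceSubgroup ι q ↔ ∃ A : Matrix ι ι ℤ, (g : Matrix ι ι ℤ) = 1 + (q : ℤ) • A := by
  rw [congruenceSubgroup, MonoidHom.mem_ker]
  constructor
  · intro h
    have hd : ∀ i j, (q : ℤ) ∣ ((g : Matrix ι ι ℤ) - 1) i j := fun i j => by
      rw [← ZMod.intCast_zmod_eq_zero_iff_dvd]
      have := congrFun (congrFun (congrArg (fun u : Matrix.SpecialLinearGroup ι (ZMod q) =>
        (u : Matrix ι ι (ZMod q))) h) i) j
      simp only [Matrix.SpecialLinearGroup.map_apply_coe, Matrix.SpecialLinearGroup.coe_one,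
        RingHom.mapMatrix_apply, Matrix.map_apply, eq_intCast] at this
      rw [Matrix.sub_apply, Int.cast_sub, this]
      by_cases hij : i = j
      · subst hij; simp
      · simp [hij]
    choose A hA using hd
    refine ⟨Matrix.of A, ?_⟩
    ext i j
    rw [Matrix.add_apply, Matrix.smul_apply, Matrix.of_apply, smul_eq_mul, ← hA, Matrix.sub_apply]
    ring
  · rintro ⟨A, hA⟩
    apply Subtype.ext
    ext i j
    rw [Matrix.SpecialLinearGroup.map_apply_coe, hA, RingHom.mapMatrix_apply, Matrix.map_apply,
      Matrix.add_apply, Matrix.smul_apply, smul_eq_mul]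
    by_cases hij : i = j
    · subst hij; simp
    · simp [hij]

theorem rankOneTransvection_mem_congruenceSubgroup {q : ℕ} {x y : ι → ℤ}
    (h : y ⬝ᵥ ((q : ℤ) • x) = 0) :
    rankOneTransvection ((q : ℤ) • x) y h ∈ congruenceSubgroup ι q :=
  mem_congruenceSubgroup_iff.2 ⟨vecMulVec x y, by rw [coe_rankOneTransvection, smul_vecMulVec]⟩

theorem exists_mulVec_eq_of_mem_congruenceSubgroup {q : ℕ} {g : Matrix.SpecialLinearGroup ι ℤ}
    (hg : g ∈ congruenceSubgroup ι q) (x : ι → ℤ) :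
    ∃ w : ι → ℤ, (g : Matrix ι ι ℤ) *ᵥ x = x + (q : ℤ) • w := by
  obtain ⟨A, hA⟩ := mem_congruenceSubgroup_iff.1 hg
  exact ⟨A *ᵥ x, by rw [hA, add_mulVec, one_mulVec, smul_mulVec]⟩

theorem exists_vecMul_eq_of_mem_congruenceSubgroup {q : ℕ} {g : Matrix.SpecialLinearGroup ι ℤ}
    (hg : g ∈ congruenceSubgroup ι q) (y : ι → ℤ) :
    ∃ w : ι → ℤ, y ᵥ* (g : Matrix ι ι ℤ) = y + (q : ℤ) • w := by
  obtain ⟨A, hA⟩ := mem_congruenceSubgroup_iff.1 hg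
  exact ⟨y ᵥ* A, by rw [hA, vecMul_add, vecMul_one, vecMul_smul]⟩

/-- The elements whose image in `SL(ι, ℤ) ⧸ N` is central. -/
def centralModulo (N : Subgroup (Matrix.SpecialLinearGroup ι ℤ)) [N.Normal] :
    Subgroup (Matrix.SpecialLinearGroup ι ℤ) :=
  (Subgroup.center (Matrix.SpecialLinearGroup ι ℤ ⧸ N)).comap (QuotientGroup.mk' N)

instance (N : Subgroup (Matrix.SpecialLinearGroup ι ℤ)) [N.Normal] : (centralModulo N).Normal :=
  inferInstanceAs (Subgroup.Normal (Subgroup.comap _ _))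

theorem le_centralModulo (N : Subgroup (Matrix.SpecialLinearGroup ι ℤ)) [N.Normal] :
    N ≤ centralModulo N := fun n hn => by
  rw [centralModulo, Subgroup.mem_comap, QuotientGroup.mk'_apply,
    (QuotientGroup.eq_one_iff n).2 hn]
  exact one_mem _

section

variable {N : Subgroup (Matrix.SpecialLinearGroup ι ℤ)} [N.Normal] {q : ℕ} {o : ι}
  {g : Matrix.SpecialLinearGroup ι ℤ}

theorem mem_centralModulo_of_fixes_row_column [NeZero q]
    (hN : ∀ i j, i ≠ j → HasTransvection N (Pi.single i (q : ℤ)) (Pi.single j 1))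
    (hg : g ∈ congruenceSubgroup ι q)
    (hcol : (g : Matrix ι ι ℤ) *ᵥ Pi.single o 1 = Pi.single o 1)
    (hrow : Pi.single o 1 ᵥ* (g : Matrix ι ι ℤ) = Pi.single o 1) : g ∈ centralModulo N := by
  set D : Subgroup (Matrix.SpecialLinearGroup ι ℤ) :=
    (Subgroup.centralizer {(QuotientGroup.mk' N g)}).comap (QuotientGroup.mk' N) with hD
  have hmem : ∀ h n, n ∈ N → g * h * g⁻¹ = n * h → h ∈ D := fun h n hn e => by
    rw [hD, Subgroup.mem_comap, Subgroup.mem_centralizer_singleton_iff, ← map_mul, ← map_mul]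
    have : h * g = n⁻¹ * (g * h) := by
      rw [eq_inv_mul_iff_mul_eq, ← mul_assoc, ← e, inv_mul_cancel_right]
    rw [this, map_mul, map_inv, QuotientGroup.mk'_apply N n, (QuotientGroup.eq_one_iff n).2 hn,
      inv_one, one_mul]
  have hcol' : ∀ a : ℤ, (g : Matrix ι ι ℤ) *ᵥ Pi.single o a = Pi.single o a := fun a => by
    have : (Pi.single o a : ι → ℤ) = a • Pi.single o 1 := by simp [← Pi.single_smul]
    rw [this, mulVec_smul, hcol]
  have hrow' : Pi.single o 1 ᵥ* ((g⁻¹ : Matrix.SpecialLinearGroup ι ℤ) : Matrix ι ι ℤ) =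
      Pi.single o 1 := by
    conv_lhs => rw [← hrow]
    rw [vecMul_vecMul, ← Matrix.SpecialLinearGroup.coe_mul, mul_inv_cancel,
      Matrix.SpecialLinearGroup.coe_one, vecMul_one]
  have h1 : ∀ j a, j ≠ o → HasTransvection D (Pi.single o a) (Pi.single j 1) := fun j a hj => by
    have h0 : (Pi.single j 1 : ι → ℤ) ⬝ᵥ Pi.single o a = 0 := by simp [hj]
    obtain ⟨w, hw⟩ := exists_vecMul_eq_of_mem_congruenceSubgroup (inv_mem hg) (Pi.single j 1)
    have hwo : w o = 0 := by
      have := dotProduct_vecMul_inv_mulVec g (Pi.single o 1) (Pi.single j 1)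
      rw [hcol, hw] at this
      simpa [hj, NeZero.ne q] using this
    have h2 : HasTransvection N (Pi.single o 1) ((q : ℤ) • w) :=
      HasTransvection.smul_right_of_smul_left (by simp [hwo]) (by
        rw [← Pi.single_smul, smul_eq_mul, mul_one]
        exact hasTransvection_right_of_single (fun j hj => hN o j hj) hwo)
    have h3 := h2.smul_left a
    rw [← Pi.single_smul, smul_eq_mul, mul_one] at h3
    obtain ⟨h3, h4⟩ := h3
    refine ⟨h0, hmem _ _ h4 ?_⟩
    rw [conj_rankOneTransvection, rankOneTransvection_mul_of_right]
    congr 1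
    · exact hcol' a
    · rw [hw, add_comm]
  have h2 : ∀ j a, j ≠ o → HasTransvection D (Pi.single j a) (Pi.single o 1) := fun j a hj => by
    have h0 : (Pi.single o 1 : ι → ℤ) ⬝ᵥ Pi.single j a = 0 := by simp [hj.symm]
    obtain ⟨w, hw⟩ := exists_mulVec_eq_of_mem_congruenceSubgroup hg (Pi.single j a)
    have hwo : w o = 0 := by
      have := dotProduct_vecMul_inv_mulVec g (Pi.single j a) (Pi.single o 1)
      rw [hrow', hw] at this
      simpa [hj.symm, NeZero.ne q] using this
    obtain ⟨h3, h4⟩ := hasTransvection_left_of_single (fun j hj => hN j o hj) hwo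
    refine ⟨h0, hmem _ _ h4 ?_⟩
    rw [conj_rankOneTransvection, rankOneTransvection_mul_of_left]
    congr 1
    rw [hw, add_comm]
  have hDtop : D = ⊤ := by
    rw [eq_top_iff, ← elementarySubgroup_univ]
    refine elementarySubgroup_le fun i _ j _ hij a => ?_
    by_cases hi : i = o
    · subst hi
      exact h1 j a hij.symm
    by_cases hj : j = o
    · subst hj
      exact h2 i a hij
    · simpa using (h2 i a hi).commutator (h1 j 1 hj) (by simp [hij])
  rw [centralModulo, Subgroup.mem_comap, Subgroup.mem_center_iff]
  intro h
  obtain ⟨h, rfl⟩ := QuotientGroup.mk'_surjective N h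
  have : h ∈ D := hDtop ▸ Subgroup.mem_top h
  rwa [hD, Subgroup.mem_comap, Subgroup.mem_centralizer_singleton_iff] at this

theorem mem_centralModulo_of_fixes_column [NeZero q]
    (hN : ∀ i j, i ≠ j → HasTransvection N (Pi.single i (q : ℤ)) (Pi.single j 1))
    (hg : g ∈ congruenceSubgroup ι q)
    (hcol : (g : Matrix ι ι ℤ) *ᵥ Pi.single o 1 = Pi.single o 1) : g ∈ centralModulo N := by
  obtain ⟨w, hw⟩ := exists_vecMul_eq_of_mem_congruenceSubgroup hg (Pi.single o 1)
  have hwo : w o = 0 := by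
    have := congrArg (fun v => (Pi.single o 1 : ι → ℤ) ⬝ᵥ v) hcol
    simp only [dotProduct_mulVec, hw] at this
    simpa [NeZero.ne q] using this
  have e : (Pi.single o (q : ℤ) : ι → ℤ) = (q : ℤ) • Pi.single o 1 := by simp [← Pi.single_smul]
  have h := hasTransvection_right_of_single (fun j hj => hN o j hj) (y := -w) (by simp [hwo])
  rw [e] at h
  obtain ⟨h, hm⟩ := h
  refine (Subgroup.mul_mem_cancel_right _ (le_centralModulo N hm)).1
    (mem_centralModulo_of_fixes_row_column (o := o) hN
      (mul_mem hg (rankOneTransvection_mem_congruenceSubgroup h)) ?_ ?_)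
  · rw [Matrix.SpecialLinearGroup.coe_mul, ← mulVec_mulVec, mulVec_rankOneTransvection]
    simpa [hwo] using hcol
  · rw [Matrix.SpecialLinearGroup.coe_mul, ← vecMul_vecMul, hw, coe_rankOneTransvection,
      vecMul_add, vecMul_one, vecMul_vecMulVec]
    have : (Pi.single o 1 + (q : ℤ) • w) ⬝ᵥ ((q : ℤ) • (Pi.single o 1 : ι → ℤ)) = q := by
      rw [add_dotProduct, smul_dotProduct, dotProduct_smul, dotProduct_smul]
      simp [hwo]
    rw [this]
    module

theorem mem_centralModulo_of_apply_eq_one [NeZero q]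
    (hN : ∀ i j, i ≠ j → HasTransvection N (Pi.single i (q : ℤ)) (Pi.single j 1))
    (hg : g ∈ congruenceSubgroup ι q)
    (h1 : ((g : Matrix ι ι ℤ) *ᵥ Pi.single o 1) o = 1) : g ∈ centralModulo N := by
  obtain ⟨w, hw⟩ := exists_mulVec_eq_of_mem_congruenceSubgroup hg (Pi.single o 1)
  have hwo : w o = 0 := by
    rw [hw] at h1
    simpa [NeZero.ne q] using h1
  obtain ⟨h, hm⟩ := hasTransvection_left_of_single (fun j hj => hN j o hj) (x := -w)
    (by simp [hwo])
  refine (Subgroup.mul_mem_cancel_left _ (le_centralModulo N hm)).1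
    (mem_centralModulo_of_fixes_column (o := o) hN
      (mul_mem (rankOneTransvection_mem_congruenceSubgroup h) hg) ?_)
  rw [Matrix.SpecialLinearGroup.coe_mul, ← mulVec_mulVec, mulVec_rankOneTransvection, hw]
  simp [hwo]

theorem mem_centralModulo_of_apply_eq [NeZero q]
    (hN : ∀ i j, i ≠ j → HasTransvection N (Pi.single i (q : ℤ)) (Pi.single j 1))
    (hg : g ∈ congruenceSubgroup ι q) {r : ι} (hr : r ≠ o)
    (h1 : ((g : Matrix ι ι ℤ) *ᵥ Pi.single o 1) r = q) : g ∈ centralModulo N := by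
  obtain ⟨w, hw⟩ := exists_mulVec_eq_of_mem_congruenceSubgroup hg (Pi.single o 1)
  have h0 : (Pi.single r 1 : ι → ℤ) ⬝ᵥ Pi.single o (-w o) = 0 := by simp [hr]
  set e := rankOneTransvection _ _ h0 with he
  have hC : e * g * e⁻¹ ∈ centralModulo N := by
    refine mem_centralModulo_of_apply_eq_one (o := o) hN
      ((inferInstanceAs (MonoidHom.ker _).Normal : (congruenceSubgroup ι q).Normal).conj_mem g hg e)
      ?_
    have h2 : ((e⁻¹ : Matrix.SpecialLinearGroup ι ℤ) : Matrix ι ι ℤ) *ᵥ Pi.single o 1 =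
        (Pi.single o 1 : ι → ℤ) := by
      rw [he, inv_rankOneTransvection, mulVec_rankOneTransvection]
      simp [hr]
    have h3 : ((g : Matrix ι ι ℤ) *ᵥ Pi.single o 1) o = 1 + q * w o := by
      rw [hw]
      simp
    rw [Matrix.SpecialLinearGroup.coe_mul, Matrix.SpecialLinearGroup.coe_mul, ← mulVec_mulVec, h2,
      ← mulVec_mulVec, he, mulVec_rankOneTransvection, single_dotProduct, one_mul, h1,
      Pi.add_apply, h3]
    simp
  simpa [mul_assoc] using (inferInstance : (centralModulo N).Normal).conj_mem _ hC e⁻¹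

theorem congruenceSubgroup_le_centralModulo [NeZero q] (hι : 3 ≤ Fintype.card ι)
    (hN : ∀ i j, i ≠ j → HasTransvection N (Pi.single i (q : ℤ)) (Pi.single j 1)) :
    congruenceSubgroup ι q ≤ centralModulo N := by
  intro g hg
  obtain ⟨o, p, r, hop, hor, hpr⟩ := Fintype.two_lt_card_iff.1 hι
  obtain ⟨h, hh, -, h0, -⟩ := exists_elementary_gcd_finset (s := ({o}ᶜ : Set ι)) (i := p)
    (by simpa using hop.symm) ({o, p}ᶜ : Finset ι) (by intro x; simp) (by simp)
    ((g : Matrix ι ι ℤ) *ᵥ Pi.single o 1)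
  have hC : h * g * h⁻¹ ∈ centralModulo N := by
    have hg₁ : h * g * h⁻¹ ∈ congruenceSubgroup ι q :=
      (inferInstanceAs (MonoidHom.ker _).Normal : (congruenceSubgroup ι q).Normal).conj_mem g hg h
    set g₁ := h * g * h⁻¹ with hg₁_def
    rw [mulVec_mulVec, ← Matrix.SpecialLinearGroup.coe_mul,
      ← mulVec_single_of_mem_elementarySubgroup (by simp : o ∉ ({o}ᶜ : Set ι)) (inv_mem hh),
      mulVec_mulVec, ← Matrix.SpecialLinearGroup.coe_mul, ← hg₁_def] at h0
    set v := (g₁ : Matrix ι ι ℤ) *ᵥ Pi.single o 1 with hv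
    set y := Pi.single o 1 ᵥ* ((g₁⁻¹ : Matrix.SpecialLinearGroup ι ℤ) : Matrix ι ι ℤ)
      with hy
    have hyv : y o * v o + y p * v p = 1 := by
      have h1 : y ⬝ᵥ v = 1 := by rw [hy, hv, dotProduct_vecMul_inv_mulVec]; simp
      rw [← h1, dotProduct, ← Finset.sum_subset (Finset.subset_univ {o, p})]
      · rw [Finset.sum_pair hop]
      · intro k _ hk
        rw [h0 k (by simpa using hk), mul_zero]
    have h2 := hasTransvection_right_of_single (fun j hj => hN r j hj)
      (y := Pi.single o (y o) + Pi.single p (y p)) (by simp [hor.symm, hpr.symm])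
    have e : (Pi.single r (q : ℤ) : ι → ℤ) = (q : ℤ) • Pi.single r 1 := by simp [← Pi.single_smul]
    rw [e] at h2
    obtain ⟨h2, hm⟩ := h2
    refine (Subgroup.mul_mem_cancel_left _ (le_centralModulo N hm)).1
      (mem_centralModulo_of_apply_eq hN
        (mul_mem (rankOneTransvection_mem_congruenceSubgroup h2) hg₁) hor.symm ?_)
    rw [Matrix.SpecialLinearGroup.coe_mul, ← mulVec_mulVec, mulVec_rankOneTransvection, ← hv]
    simp only [Pi.add_apply, h0 r (by simp [hor.symm, hpr.symm]), add_dotProduct,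
      single_dotProduct, hyv]
    simp
  simpa [mul_assoc] using (inferInstance : (centralModulo N).Normal).conj_mem _ hC h⁻¹

end

open scoped commutatorElement in
theorem finite_of_commutator_eq_top_of_finiteIndex_center {G : Type*} [Group G]
    (hG : _root_.commutator G = ⊤) [(Subgroup.center G).FiniteIndex] : Finite G := by
  have : Finite (commutatorSet G) := by
    let f : (G ⧸ Subgroup.center G) × (G ⧸ Subgroup.center G) → G := fun p => ⁅p.1.out, p.2.out⁆
    refine (Set.finite_range f).subset ?_
    rintro _ ⟨a, b, rfl⟩
    refine ⟨(a, b), ?_⟩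
    obtain ⟨c, hc⟩ := QuotientGroup.mk_out_eq_mul (Subgroup.center G) a
    obtain ⟨d, hd⟩ := QuotientGroup.mk_out_eq_mul (Subgroup.center G) b
    have hc' := Subgroup.mem_center_iff.1 c.2
    have hd' := Subgroup.mem_center_iff.1 d.2
    change ⁅(a : G ⧸ Subgroup.center G).out, (b : G ⧸ Subgroup.center G).out⁆ = _
    rw [hc, hd, commutatorElement_def, commutatorElement_def, _root_.mul_inv_rev,
      _root_.mul_inv_rev]
    calc a * c * (b * d) * ((c : G)⁻¹ * a⁻¹) * ((d : G)⁻¹ * b⁻¹)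
        = a * (c * (b * d)) * ((c : G)⁻¹ * a⁻¹) * ((d : G)⁻¹ * b⁻¹) := by group
      _ = a * b * (d * a⁻¹) * ((d : G)⁻¹ * b⁻¹) := by rw [← hc']; group
      _ = _ := by rw [← hd']; group
  have : Finite (_root_.commutator G) := inferInstance
  rw [hG] at this
  exact Finite.of_equiv _ Subgroup.topEquiv.toEquiv

theorem exists_ne_ne (hι : 3 ≤ Fintype.card ι) (i j : ι) : ∃ k, k ≠ i ∧ k ≠ j := by
  obtain ⟨k, hk⟩ : ∃ k, k ∉ ({i, j} : Finset ι) := by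
    by_contra! h
    have := Finset.card_le_card (fun x _ => h x : (Finset.univ : Finset ι) ⊆ {i, j})
    have := Finset.card_le_two (a := i) (b := j)
    rw [Finset.card_univ] at *
    lia
  rw [Finset.mem_insert, Finset.mem_singleton, not_or] at hk
  exact ⟨k, hk⟩

open scoped commutatorElement in
theorem commutator_eq_top (hι : 3 ≤ Fintype.card ι) :
    _root_.commutator (Matrix.SpecialLinearGroup ι ℤ) = ⊤ := by
  rw [eq_top_iff, ← elementarySubgroup_univ]
  refine elementarySubgroup_le fun i _ j _ hij a => ⟨by simp [hij.symm], ?_⟩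
  obtain ⟨k, hk⟩ := exists_ne_ne hι i j
  have h1 : (Pi.single k 1 : ι → ℤ) ⬝ᵥ Pi.single i a = 0 := by simp [hk.1]
  have h2 : (Pi.single j 1 : ι → ℤ) ⬝ᵥ Pi.single k 1 = 0 := by simp [Ne.symm hk.2]
  have : rankOneTransvection (Pi.single i a) (Pi.single j 1) (by simp [hij.symm]) =
      ⁅rankOneTransvection _ _ h1, rankOneTransvection _ _ h2⁆ := by
    rw [commutatorElement_def, rankOneTransvection_commutator _ _ (by simp [hij.symm])]
    congr 1
    simp
  rw [this]
  exact Subgroup.commutator_mem_commutator (Subgroup.mem_top _) (Subgroup.mem_top _)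

theorem finiteIndex_of_normal (hι : 3 ≤ Fintype.card ι)
    {N : Subgroup (Matrix.SpecialLinearGroup ι ℤ)} [N.Normal] {q : ℕ} [NeZero q]
    (hN : ∀ i j, i ≠ j → HasTransvection N (Pi.single i (q : ℤ)) (Pi.single j 1)) :
    N.FiniteIndex := by
  have h1 : (congruenceSubgroup ι q).FiniteIndex :=
    inferInstanceAs (MonoidHom.ker _).FiniteIndex
  have h2 : (centralModulo N).FiniteIndex :=
    Subgroup.finiteIndex_of_le (congruenceSubgroup_le_centralModulo hι hN)
  have h3 : (Subgroup.center (Matrix.SpecialLinearGroup ι ℤ ⧸ N)).FiniteIndex := by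
    refine ⟨?_⟩
    rw [← Subgroup.index_comap_of_surjective _ (QuotientGroup.mk'_surjective N)]
    exact h2.index_ne_zero
  have h4 : _root_.commutator (Matrix.SpecialLinearGroup ι ℤ ⧸ N) = ⊤ := by
    rw [commutator_def, ← MonoidHom.range_eq_top.2 (QuotientGroup.mk'_surjective N),
      MonoidHom.range_eq_map, ← Subgroup.map_commutator, ← commutator_def, commutator_eq_top hι]
  have := finite_of_commutator_eq_top_of_finiteIndex_center h4
  exact Subgroup.finiteIndex_of_finite_quotient

theorem hasTransvection_single_sub_single (hι : 3 ≤ Fintype.card ι)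
    {H : Subgroup (Matrix.SpecialLinearGroup ι ℤ)} {q : ℤ}
    (hH : ∀ i j, i ≠ j → HasTransvection H (Pi.single i q) (Pi.single j 1)) (y : ι → ℤ) {i j : ι}
    (hij : i ≠ j) :
    HasTransvection H (q ^ 2 • (Pi.single i (y j) - Pi.single j (y i))) y := by
  obtain ⟨k, hki, hkj⟩ := exists_ne_ne hι i j
  set p : ι → ℤ := Pi.single i (y i) + Pi.single j (y j) with hp
  set x : ι → ℤ := Pi.single i (y j) - Pi.single j (y i) with hx
  have h1 : HasTransvection H (q ^ 2 • x) p := by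
    have h := (hasTransvection_left_of_single (x := x) (fun l hl => hH l k hl)
      (by simp [hx, hki, hkj])).commutator (hasTransvection_right_of_single
        (fun l hl => hH k l hl) (y := p) (by simp [hp, hki, hkj]))
      (by simp [hp, hx, hij, hij.symm, mul_sub]; ring)
    rwa [single_dotProduct, one_mul, Pi.single_eq_same, smul_smul, ← pow_two] at h
  have h2 : HasTransvection H (q ^ 2 • x) (y - p) := by
    have hi := hasTransvection_right_of_single (fun l hl => hH i l hl) (y := y - p)
      (by simp [hp, hij])
    have hj := hasTransvection_right_of_single (fun l hl => hH j l hl) (y := y - p)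
      (by simp [hp, hij.symm])
    convert (hi.smul_left (q * y j)).add_left (hj.smul_left (-(q * y i))) using 1
    rw [hx, ← Pi.single_smul, ← Pi.single_smul, smul_sub, ← Pi.single_smul, ← Pi.single_smul,
      sub_eq_add_neg, ← Pi.single_neg]
    simp only [smul_eq_mul]
    congr 2 <;> ring
  simpa using h1.add_right h2

theorem hasTransvection_sq_smul (hι : 3 ≤ Fintype.card ι)
    {H : Subgroup (Matrix.SpecialLinearGroup ι ℤ)} {q : ℤ}
    (hH : ∀ i j, i ≠ j → HasTransvection H (Pi.single i q) (Pi.single j 1)) {x y z : ι → ℤ}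
    (hyx : y ⬝ᵥ x = 0) (hyz : y ⬝ᵥ z = 1) : HasTransvection H (q ^ 2 • x) y := by
  have e : x = ∑ i, ∑ j, (x i * z j) • (Pi.single i (y j) - Pi.single j (y i)) := by
    ext l
    simp only [smul_sub, Finset.sum_sub_distrib, ← Pi.single_smul, smul_eq_mul, Pi.sub_apply,
      Finset.sum_apply]
    rw [Finset.sum_comm]
    simp only [Finset.sum_pi_single, Finset.mem_univ, if_true]
    have h1 : ∑ j, x l * z j * y j = x l := by
      refine Eq.trans ?_ (mul_one (x l))
      rw [← hyz, dotProduct, Finset.mul_sum]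
      exact Finset.sum_congr rfl fun j _ => by ring
    have h2 : ∑ i, x i * z l * y i = 0 := by
      rw [← mul_zero (z l), ← hyx, dotProduct, Finset.mul_sum]
      exact Finset.sum_congr rfl fun j _ => by ring
    rw [h1, h2, sub_zero]
  rw [e, Finset.smul_sum]
  refine HasTransvection.sum_left _ _ fun i _ => ?_
  rw [Finset.smul_sum]
  refine HasTransvection.sum_left _ _ fun j _ => ?_
  by_cases hij : i = j
  · subst hij
    simpa using HasTransvection.zero_left H y
  · rw [smul_comm]
    exact (hasTransvection_single_sub_single hι hH y hij).smul_left _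

theorem finiteIndex_of_hasTransvection_single (hι : 3 ≤ Fintype.card ι)
    {H : Subgroup (Matrix.SpecialLinearGroup ι ℤ)} {q : ℤ} (hq : q ≠ 0)
    (hH : ∀ i j, i ≠ j → HasTransvection H (Pi.single i q) (Pi.single j 1)) : H.FiniteIndex := by
  let N := Subgroup.normalClosure {g : Matrix.SpecialLinearGroup ι ℤ |
    ∃ i j, ∃ hij : i ≠ j, g = rankOneTransvection (Pi.single i (q ^ 2)) (Pi.single j 1)
      (by simp [hij.symm])}
  have : NeZero (q ^ 2).natAbs := ⟨by simpa using hq⟩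
  have hN : N.FiniteIndex := by
    refine finiteIndex_of_normal hι (q := (q ^ 2).natAbs) fun i j hij => ?_
    rw [Int.natAbs_of_nonneg (sq_nonneg q)]
    exact ⟨_, Subgroup.subset_normalClosure ⟨i, j, hij, rfl⟩⟩
  refine Subgroup.finiteIndex_of_le (H := N) ?_
  refine (Subgroup.closure_le H).2 fun g hg => ?_
  obtain ⟨_, ⟨i, j, hij, rfl⟩, hc⟩ := Group.mem_conjugatesOfSet_iff.1 hg
  obtain ⟨c, rfl⟩ := isConj_iff.1 hc
  rw [conj_rankOneTransvection]
  have h := hasTransvection_sq_smul hι hH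
    (x := (c : Matrix ι ι ℤ) *ᵥ Pi.single i 1)
    (y := Pi.single j 1 ᵥ* ((c⁻¹ : Matrix.SpecialLinearGroup ι ℤ) : Matrix ι ι ℤ))
    (z := (c : Matrix ι ι ℤ) *ᵥ Pi.single j 1)
    (by rw [dotProduct_vecMul_inv_mulVec]; simp [hij.symm])
    (by rw [dotProduct_vecMul_inv_mulVec]; simp)
  rw [← mulVec_smul, ← Pi.single_smul, smul_eq_mul, mul_one] at h
  exact h.2

/-- Some nonzero multiple of `x` is a column of a transvection in `H` with row `y`. -/
def VirtuallyHasTransvection (H : Subgroup (Matrix.SpecialLinearGroup ι ℤ)) (x y : ι → ℤ) : Prop :=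
  ∃ c : ℤ, c ≠ 0 ∧ HasTransvection H (c • x) y

namespace VirtuallyHasTransvection

variable {H : Subgroup (Matrix.SpecialLinearGroup ι ℤ)} {x x' y y' z z' : ι → ℤ}

theorem of_hasTransvection (h : HasTransvection H x y) : VirtuallyHasTransvection H x y :=
  ⟨1, one_ne_zero, by rwa [one_smul]⟩

theorem dotProduct_eq_zero (h : VirtuallyHasTransvection H x y) : y ⬝ᵥ x = 0 := by
  obtain ⟨c, hc, h, -⟩ := h
  rw [dotProduct_smul, smul_eq_mul] at h
  exact (mul_eq_zero.1 h).resolve_left hc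

theorem zero_left (H : Subgroup (Matrix.SpecialLinearGroup ι ℤ)) (y : ι → ℤ) :
    VirtuallyHasTransvection H 0 y :=
  of_hasTransvection (HasTransvection.zero_left H y)

theorem add_left (h : VirtuallyHasTransvection H x y) (h' : VirtuallyHasTransvection H x' y) :
    VirtuallyHasTransvection H (x + x') y := by
  obtain ⟨c, hc, h⟩ := h
  obtain ⟨c', hc', h'⟩ := h'
  refine ⟨c * c', mul_ne_zero hc hc', ?_⟩
  convert (h.smul_left c').add_left (h'.smul_left c) using 1
  module

theorem smul_left (a : ℤ) (h : VirtuallyHasTransvection H x y) :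
    VirtuallyHasTransvection H (a • x) y := by
  obtain ⟨c, hc, h⟩ := h
  exact ⟨c, hc, by rw [smul_comm]; exact h.smul_left a⟩

theorem of_smul_left {a : ℤ} (ha : a ≠ 0) (h : VirtuallyHasTransvection H (a • x) y) :
    VirtuallyHasTransvection H x y := by
  obtain ⟨c, hc, h⟩ := h
  exact ⟨c * a, mul_ne_zero hc ha, by rwa [mul_smul]⟩

theorem smul_right (a : ℤ) (h : VirtuallyHasTransvection H x y) :
    VirtuallyHasTransvection H x (a • y) := by
  obtain ⟨c, hc, h⟩ := h
  exact ⟨c, hc, h.smul_right a⟩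

theorem of_smul_right {a : ℤ} (ha : a ≠ 0) (h : VirtuallyHasTransvection H x (a • y)) :
    VirtuallyHasTransvection H x y := by
  have hyx : y ⬝ᵥ x = 0 := by
    have := h.dotProduct_eq_zero
    rw [smul_dotProduct, smul_eq_mul] at this
    exact (mul_eq_zero.1 this).resolve_left ha
  obtain ⟨c, hc, h⟩ := h
  refine ⟨a * c, mul_ne_zero ha hc, ?_⟩
  rw [mul_smul]
  exact h.smul_left_of_smul_right (by rw [dotProduct_smul, hyx, smul_zero])

theorem add_right (h : VirtuallyHasTransvection H x y) (h' : VirtuallyHasTransvection H x y') :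
    VirtuallyHasTransvection H x (y + y') := by
  obtain ⟨c, hc, h⟩ := h
  obtain ⟨c', hc', h'⟩ := h'
  refine ⟨c * c', mul_ne_zero hc hc', HasTransvection.add_right ?_ ?_⟩
  · rw [mul_comm, mul_smul]
    exact h.smul_left c'
  · rw [mul_smul]
    exact h'.smul_left c

theorem sum_left {α : Type*} (s : Finset α) (f : α → ι → ℤ)
    (h : ∀ a ∈ s, VirtuallyHasTransvection H (f a) y) :
    VirtuallyHasTransvection H (∑ a ∈ s, f a) y :=
  Finset.sum_induction f (VirtuallyHasTransvection H · y) (fun _ _ => add_left) (zero_left H y) h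

theorem commutator (h : VirtuallyHasTransvection H x z) (h' : VirtuallyHasTransvection H z' y)
    (hyx : y ⬝ᵥ x = 0) (hz : z ⬝ᵥ z' ≠ 0) : VirtuallyHasTransvection H x y := by
  obtain ⟨c, hc, h⟩ := h
  obtain ⟨c', hc', h'⟩ := h'
  refine ⟨(z ⬝ᵥ (c' • z')) * c, ?_, ?_⟩
  · rw [dotProduct_smul]
    exact mul_ne_zero (mul_ne_zero hc' hz) hc
  · rw [mul_smul]
    exact h.commutator h' (by rw [dotProduct_smul, hyx, smul_zero])

theorem conj {g : Matrix.SpecialLinearGroup ι ℤ} (h : VirtuallyHasTransvection H x y)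
    (hg : g ∈ H) : VirtuallyHasTransvection H ((g : Matrix ι ι ℤ) *ᵥ x)
      (y ᵥ* ((g⁻¹ : Matrix.SpecialLinearGroup ι ℤ) : Matrix ι ι ℤ)) := by
  obtain ⟨c, hc, h⟩ := h
  refine ⟨c, hc, ?_⟩
  rw [← mulVec_smul]
  exact h.conj fun k hk => H.mul_mem (H.mul_mem hg hk) (H.inv_mem hg)

end VirtuallyHasTransvection

/-- For every `x` with `y x = 0`, some nonzero power of the transvection `1 + x yᵀ` is in `H`. -/
def VirtuallyHasRow (H : Subgroup (Matrix.SpecialLinearGroup ι ℤ)) (y : ι → ℤ) : Prop :=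
  ∀ x, y ⬝ᵥ x = 0 → VirtuallyHasTransvection H x y

namespace VirtuallyHasRow

variable {H : Subgroup (Matrix.SpecialLinearGroup ι ℤ)} {y y' ζ : ι → ℤ}

theorem of_smul {a : ℤ} (ha : a ≠ 0) (h : VirtuallyHasRow H (a • y)) : VirtuallyHasRow H y :=
  fun x hx => (h x (by rw [smul_dotProduct, hx, smul_zero])).of_smul_right ha

theorem vecMul {g : Matrix.SpecialLinearGroup ι ℤ} (h : VirtuallyHasRow H y) (hg : g ∈ H) :
    VirtuallyHasRow H (y ᵥ* (g : Matrix ι ι ℤ)) := fun x hx => by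
  have := (h ((g : Matrix ι ι ℤ) *ᵥ x) (by rwa [dotProduct_mulVec])).conj (H.inv_mem hg)
  rwa [mulVec_mulVec, coe_inv_mul_coe, one_mulVec, inv_inv] at this

theorem sub (h : VirtuallyHasRow H y) (h' : VirtuallyHasRow H y') (hζ : VirtuallyHasRow H ζ)
    {ζ' : ι → ℤ} (h0 : y ⬝ᵥ ζ' = 0) (h0' : y' ⬝ᵥ ζ' = 0) (h1 : ζ ⬝ᵥ ζ' ≠ 0) :
    VirtuallyHasRow H (y' - y) := fun x hx => by
  have h2 : VirtuallyHasTransvection H ζ' (y' - y) := by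
    convert (h' ζ' h0').add_right ((h ζ' h0).smul_right (-1)) using 1
    module
  have h3 : VirtuallyHasTransvection H ((ζ ⬝ᵥ ζ') • x - (ζ ⬝ᵥ x) • ζ') (y' - y) := by
    refine (hζ _ ?_).commutator h2 ?_ h1
    · rw [dotProduct_sub, dotProduct_smul, dotProduct_smul, smul_eq_mul, smul_eq_mul]
      ring
    · rw [dotProduct_sub, dotProduct_smul, dotProduct_smul, hx, sub_dotProduct, h0, h0']
      simp
  refine VirtuallyHasTransvection.of_smul_left h1 ?_
  simpa using h3.add_left (h2.smul_left (ζ ⬝ᵥ x))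

end VirtuallyHasRow

theorem exists_hasTransvection_single_of_virtuallyHasTransvection
    {H : Subgroup (Matrix.SpecialLinearGroup ι ℤ)}
    (h : ∀ i j, i ≠ j → VirtuallyHasTransvection H (Pi.single i 1) (Pi.single j 1)) :
    ∃ q : ℤ, q ≠ 0 ∧ ∀ i j, i ≠ j → HasTransvection H (Pi.single i q) (Pi.single j 1) := by
  have h' : ∀ p : ι × ι, ∃ c : ℤ, c ≠ 0 ∧
      (p.1 ≠ p.2 → HasTransvection H (Pi.single p.1 c) (Pi.single p.2 1)) := fun p => by
    by_cases hp : p.1 = p.2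
    · exact ⟨1, one_ne_zero, fun hp' => absurd hp hp'⟩
    · obtain ⟨c, hc, h⟩ := h _ _ hp
      rw [← Pi.single_smul, smul_eq_mul, mul_one] at h
      exact ⟨c, hc, fun _ => h⟩
  choose c hc hH using h'
  refine ⟨∏ p, c p, Finset.prod_ne_zero_iff.2 fun p _ => hc p, fun i j hij => ?_⟩
  obtain ⟨d, hd⟩ := Finset.dvd_prod_of_mem c (Finset.mem_univ (i, j))
  have := (hH (i, j) hij).smul_left d
  rwa [← Pi.single_smul, smul_eq_mul, mul_comm, ← hd] at this

theorem rankOneTransvection_pow {x y : ι → ℤ} (h : y ⬝ᵥ x = 0) (k : ℕ) :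
    rankOneTransvection x y h ^ k =
      rankOneTransvection ((k : ℤ) • x) y (by rw [dotProduct_smul, h, smul_zero]) := by
  induction k with
  | zero =>
    apply Subtype.ext
    rw [coe_rankOneTransvection, pow_zero, Nat.cast_zero, zero_smul, zero_vecMulVec, add_zero]
    rfl
  | succ k ih =>
    rw [pow_succ, ih, rankOneTransvection_mul_of_left]
    congr 1
    push_cast
    module

section Chain

variable {n : ℕ}

/-- The `k`-th standard basis vector of `ℤⁿ` if `k < n`, and `0` otherwise. -/
def basisVector (n k : ℕ) : Fin n → ℤ := fun i => if (i : ℕ) = k then 1 else 0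

theorem single_eq_basisVector (i : Fin n) : (Pi.single i 1 : Fin n → ℤ) = basisVector n i := by
  ext j
  simp [basisVector, Pi.single_apply, Fin.ext_iff]

theorem basisVector_dotProduct_self {k : ℕ} (hk : k < n) :
    basisVector n k ⬝ᵥ basisVector n k = 1 := by
  rw [show basisVector n k = Pi.single ⟨k, hk⟩ 1 from (single_eq_basisVector ⟨k, hk⟩).symm]
  simp

theorem basisVector_dotProduct_of_ne {k l : ℕ} (h : k ≠ l) :
    basisVector n k ⬝ᵥ basisVector n l = 0 :=
  Finset.sum_eq_zero fun i _ => by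
    simp only [basisVector, mul_ite, mul_one, mul_zero]
    split_ifs <;> first | rfl | lia

/-- The upper unitriangular matrix, truncated after `k` rows, with `a` above the diagonal. -/
def jordanMatrix (n : ℕ) (a : ℤ) (k : ℕ) : Matrix (Fin n) (Fin n) ℤ :=
  1 + ∑ j ∈ Finset.range k, vecMulVec (a • basisVector n j) (basisVector n (j + 1))

theorem exists_coe_eq_jordanMatrix {Γ : Subgroup (Matrix.SpecialLinearGroup (Fin n) ℤ)} {a : ℤ}
    (hΓ : ∀ i, HasTransvection Γ (a • basisVector n i) (basisVector n (i + 1))) (k : ℕ) :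
    ∃ g ∈ Γ, (g : Matrix (Fin n) (Fin n) ℤ) = jordanMatrix n a k := by
  induction k with
  | zero => exact ⟨1, Γ.one_mem, by simp [jordanMatrix]⟩
  | succ k ih =>
    obtain ⟨g, hg, e⟩ := ih
    obtain ⟨h, hm⟩ := hΓ k
    refine ⟨_, Γ.mul_mem hm hg, ?_⟩
    have h0 : vecMulVec (a • basisVector n k) (basisVector n (k + 1)) *
        ∑ j ∈ Finset.range k, vecMulVec (a • basisVector n j) (basisVector n (j + 1)) = 0 := by
      rw [Finset.mul_sum]
      refine Finset.sum_eq_zero fun j hj => ?_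
      have := Finset.mem_range.1 hj
      rw [vecMulVec_mul_vecMulVec, dotProduct_smul, basisVector_dotProduct_of_ne (by lia),
        smul_zero, zero_smul, vecMulVec_zero]
    rw [Matrix.SpecialLinearGroup.coe_mul, e, coe_rankOneTransvection, jordanMatrix, jordanMatrix,
      Finset.sum_range_succ, add_mul, one_mul, mul_add, mul_one, h0, add_zero, add_assoc]

theorem jordanMatrix_mulVec_zero (a : ℤ) (k : ℕ) :
    jordanMatrix n a k *ᵥ basisVector n 0 = basisVector n 0 := by
  rw [jordanMatrix, add_mulVec, one_mulVec, sum_mulVec, Finset.sum_eq_zero, add_zero]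
  intro j _
  rw [vecMulVec_mulVec, basisVector_dotProduct_of_ne (by lia)]
  simp

theorem jordanMatrix_mulVec_succ (a : ℤ) {k j : ℕ} (hj : j < k) (hn : j + 1 < n) :
    jordanMatrix n a k *ᵥ basisVector n (j + 1) = basisVector n (j + 1) + a • basisVector n j := by
  rw [jordanMatrix, add_mulVec, one_mulVec, sum_mulVec,
    Finset.sum_eq_single_of_mem j (Finset.mem_range.2 hj), vecMulVec_mulVec,
    basisVector_dotProduct_self hn]
  · simp
  · intro i _ hi
    rw [vecMulVec_mulVec, basisVector_dotProduct_of_ne (by lia)]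
    simp

theorem vecMul_jordanMatrix (a : ℤ) {k j : ℕ} (hj : j < k) (hn : j < n) :
    basisVector n j ᵥ* jordanMatrix n a k = basisVector n j + a • basisVector n (j + 1) := by
  rw [jordanMatrix, vecMul_add, vecMul_one, vecMul_sum,
    Finset.sum_eq_single_of_mem j (Finset.mem_range.2 hj), vecMul_vecMulVec, dotProduct_smul,
    basisVector_dotProduct_self hn]
  · simp
  · intro i _ hi
    rw [vecMul_vecMulVec, dotProduct_smul, basisVector_dotProduct_of_ne (by lia)]
    simp

variable {Λ : Subgroup (Matrix.SpecialLinearGroup (Fin n) ℤ)} {a : ℤ}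
  {g : Matrix.SpecialLinearGroup (Fin n) ℤ}

theorem virtuallyHasTransvection_basisVector_zero (ha : a ≠ 0) (hg : g ∈ Λ)
    (e : (g : Matrix (Fin n) (Fin n) ℤ) = jordanMatrix n a n)
    (hu : VirtuallyHasTransvection Λ (basisVector n (n - 1)) (basisVector n 0)) (d : ℕ) {k : ℕ}
    (hk : 0 < k) (hd : k + d = n - 1) :
    VirtuallyHasTransvection Λ (basisVector n k) (basisVector n 0) := by
  have hw : ∀ j < n, (basisVector n 0 ᵥ* ((g⁻¹ : Matrix.SpecialLinearGroup (Fin n) ℤ) :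
      Matrix (Fin n) (Fin n) ℤ)) ⬝ᵥ basisVector n j ≠ 0 := by
    intro j hj
    induction j with
    | zero =>
      have h := dotProduct_vecMul_inv_mulVec g (basisVector n 0) (basisVector n 0)
      rw [e, jordanMatrix_mulVec_zero, basisVector_dotProduct_self hj] at h
      rw [h]
      exact one_ne_zero
    | succ j ih =>
      have h := dotProduct_vecMul_inv_mulVec g (basisVector n (j + 1)) (basisVector n 0)
      rw [e, jordanMatrix_mulVec_succ a (by lia) hj, dotProduct_add, dotProduct_smul,
        basisVector_dotProduct_of_ne (by lia), smul_eq_mul] at h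
      rw [eq_neg_of_add_eq_zero_left h]
      exact neg_ne_zero.2 (mul_ne_zero ha (ih (by lia)))
  induction d generalizing k with
  | zero => rwa [← hd] at hu
  | succ d ih =>
    have h1 := ih (k := k + 1) (by lia) (by lia)
    have h2 := h1.conj hg
    rw [e, jordanMatrix_mulVec_succ a (by lia) (by lia)] at h2
    have h3 := h2.commutator hu (by
      rw [dotProduct_add, dotProduct_smul, basisVector_dotProduct_of_ne (by lia),
        basisVector_dotProduct_of_ne (by lia), smul_zero, add_zero]) (hw _ (by lia))
    refine VirtuallyHasTransvection.of_smul_left ha ?_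
    simpa using h3.add_left (h1.smul_left (-1))

theorem virtuallyHasRow_basisVector (hn : 3 ≤ n) (ha : a ≠ 0) (hg : g ∈ Λ)
    (e : (g : Matrix (Fin n) (Fin n) ℤ) = jordanMatrix n a n)
    (hu : VirtuallyHasTransvection Λ (basisVector n (n - 1)) (basisVector n 0)) {k : ℕ}
    (hk : k < n) : VirtuallyHasRow Λ (basisVector n k) := by
  have h0 : VirtuallyHasRow Λ (basisVector n 0) := fun x hx => by
    rw [eq_sum_single x]
    refine VirtuallyHasTransvection.sum_left _ _ fun i _ => ?_
    have hi : (Pi.single i (x i) : Fin n → ℤ) = x i • basisVector n i := by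
      rw [← single_eq_basisVector, ← Pi.single_smul, smul_eq_mul, mul_one]
    rw [hi]
    obtain h | h := Nat.eq_zero_or_pos (i : ℕ)
    · rw [← h, ← single_eq_basisVector, single_dotProduct, one_mul] at hx
      rw [hx, zero_smul]
      exact VirtuallyHasTransvection.zero_left _ _
    · exact (virtuallyHasTransvection_basisVector_zero ha hg e hu (n - 1 - i) h
        (by lia)).smul_left _
  induction k with
  | zero => exact h0
  | succ j ih =>
    have h1 := ih (by lia)
    have h2 := h1.vecMul hg
    have h3 := h2.vecMul hg
    have e1 : basisVector n j ᵥ* (g : Matrix (Fin n) (Fin n) ℤ) =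
        basisVector n j + a • basisVector n (j + 1) := by
      rw [e, vecMul_jordanMatrix a (by lia) (by lia)]
    have e2 : basisVector n (j + 1) ᵥ* (g : Matrix (Fin n) (Fin n) ℤ) =
        basisVector n (j + 1) + a • basisVector n (j + 2) := by
      rw [e, vecMul_jordanMatrix a (by lia) (by lia)]
    rw [e1] at h2 h3
    rw [add_vecMul, smul_vecMul, e1, e2] at h3
    refine VirtuallyHasRow.of_smul ha ?_
    rw [← add_sub_cancel_left (basisVector n j) (a • basisVector n (j + 1))]
    obtain h | h := (show j + 2 ≤ n by lia).lt_or_eq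
    · refine h1.sub h2 h3 (ζ' := basisVector n (j + 2)) ?_ ?_ ?_
      · exact basisVector_dotProduct_of_ne (by lia)
      · rw [add_dotProduct, smul_dotProduct, basisVector_dotProduct_of_ne (by lia),
          basisVector_dotProduct_of_ne (by lia), smul_zero, add_zero]
      · simpa [-zsmul_eq_mul, add_dotProduct, smul_dotProduct, basisVector_dotProduct_self h,
          basisVector_dotProduct_of_ne (show j + 1 ≠ j + 2 by lia),
          basisVector_dotProduct_of_ne (show j ≠ j + 2 by lia)] using ha
    · refine h1.sub h2 h0 (ζ' := basisVector n 0) ?_ ?_ ?_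
      · exact basisVector_dotProduct_of_ne (by lia)
      · rw [add_dotProduct, smul_dotProduct, basisVector_dotProduct_of_ne (by lia),
          basisVector_dotProduct_of_ne (by lia), smul_zero, add_zero]
      · rw [basisVector_dotProduct_self (by lia)]
        exact one_ne_zero

end Chain

end Transvections

/-- **Theorem.** Let `n ≥ 3`. Every finite index subgroup of `SL(n,ℤ)` contains a
finite index subgroup generated by two elements. -/
theorem stmt1 (n : ℕ) (hn : 3 ≤ n)
    (Γ : Subgroup (Matrix.SpecialLinearGroup (Fin n) ℤ)) (hΓ : Γ.FiniteIndex) :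
    ∃ Λ : Subgroup (Matrix.SpecialLinearGroup (Fin n) ℤ),
      Λ ≤ Γ ∧ Λ.FiniteIndex ∧
      ∃ a b : Matrix.SpecialLinearGroup (Fin n) ℤ, Λ = Subgroup.closure {a, b} := by
  have hM : (Γ.normalCore.index : ℤ) ≠ 0 := Nat.cast_ne_zero.2 Subgroup.FiniteIndex.index_ne_zero
  set M := Γ.normalCore.index
  have hΓM : ∀ i j, i ≠ j →
      HasTransvection Γ ((M : ℤ) • basisVector n i) (basisVector n j) := fun i j hij => by
    have h := Γ.normalCore_le (Subgroup.pow_index_mem Γ.normalCore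
      (rankOneTransvection _ _ (basisVector_dotProduct_of_ne (n := n) hij.symm)))
    rw [rankOneTransvection_pow] at h
    exact ⟨_, h⟩
  obtain ⟨hu, hu'⟩ := hΓM (n - 1) 0 (by lia)
  obtain ⟨g, hg, e⟩ := exists_coe_eq_jordanMatrix (fun i => hΓM i (i + 1) (by lia)) n
  set u := rankOneTransvection _ _ hu
  refine ⟨Subgroup.closure {u, g}, ?_, ?_, u, g, rfl⟩
  · rw [Subgroup.closure_le, Set.insert_subset_iff, Set.singleton_subset_iff]
    exact ⟨hu', hg⟩
  have hgΛ : g ∈ Subgroup.closure {u, g} := Subgroup.subset_closure (by simp)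
  have huΛ : VirtuallyHasTransvection (Subgroup.closure {u, g})
      (basisVector n (n - 1)) (basisVector n 0) :=
    ⟨M, hM, hu, Subgroup.subset_closure (by simp [u])⟩
  obtain ⟨q, hq, h⟩ := exists_hasTransvection_single_of_virtuallyHasTransvection
    (H := Subgroup.closure {u, g}) fun i j hij => by
      rw [single_eq_basisVector, single_eq_basisVector]
      exact virtuallyHasRow_basisVector hn hM hgΛ e huΛ j.2 _
        (basisVector_dotProduct_of_ne fun h => hij (Fin.ext h.symm))
  exact finiteIndex_of_hasTransvection_single (by simpa using hn) hq h
end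

section
/- Let n ≥ 3 and m ≥ 1. Suppose Λ ≤ SL(n,ℤ) contains e_{i,j}(m) for all 1 ≤ i ≠ j ≤ n. Then Λ has finite index in SL(n,ℤ). -/
/-- The elementary matrix `e_{i,j}(t)` as an element of `SL(n, ℤ)`. -/
def Elem {n : ℕ} (i j : Fin n) (hij : i ≠ j) (t : ℤ) :
    Matrix.SpecialLinearGroup (Fin n) ℤ :=
  ⟨Matrix.transvection i j t, Matrix.det_transvection_of_ne i j hij t⟩

open scoped commutatorElement

namespace Matrix

section ElementaryMatrices

variable {ι R : Type*} [Fintype ι] [DecidableEq ι] [CommRing R]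

/-- The vectors `v` orthogonal to `w` for which `1 + v wᵀ` lies in the submonoid `S`. -/
def leftVectors (S : Submonoid (Matrix ι ι R)) (w : ι → R) : AddSubmonoid (ι → R) where
  carrier := {v | w ⬝ᵥ v = 0 ∧ 1 + vecMulVec v w ∈ S}
  zero_mem' := by simp
  add_mem' := by
    rintro a b ⟨ha, ha'⟩ ⟨hb, hb'⟩
    refine ⟨by rw [dotProduct_add, ha, hb, add_zero], ?_⟩
    have := S.mul_mem ha' hb'
    rw [mul_add, add_mul, add_mul, vecMulVec_mul_vecMulVec, hb] at this
    simpa [add_vecMulVec, add_assoc] using this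

/-- The vectors `w` orthogonal to `v` for which `1 + v wᵀ` lies in the submonoid `S`. -/
def rightVectors (S : Submonoid (Matrix ι ι R)) (v : ι → R) : AddSubmonoid (ι → R) where
  carrier := {w | w ⬝ᵥ v = 0 ∧ 1 + vecMulVec v w ∈ S}
  zero_mem' := by simp
  add_mem' := by
    rintro a b ⟨ha, ha'⟩ ⟨hb, hb'⟩
    refine ⟨by rw [add_dotProduct, ha, hb, add_zero], ?_⟩
    have := S.mul_mem ha' hb'
    rw [mul_add, add_mul, add_mul, vecMulVec_mul_vecMulVec, ha] at this
    simpa [vecMulVec_add, add_assoc] using this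

lemma one_add_vecMulVec_mem_of_commutator {S : Submonoid (Matrix ι ι R)} {x y e : ι → R}
    (hee : e ⬝ᵥ e = 1) (hex : e ⬝ᵥ x = 0) (hye : y ⬝ᵥ e = 0) (hyx : y ⬝ᵥ x = 0)
    (h₁ : 1 + vecMulVec x e ∈ S) (h₂ : 1 + vecMulVec e y ∈ S)
    (h₃ : 1 + vecMulVec (-x) e ∈ S) (h₄ : 1 + vecMulVec e (-y) ∈ S) :
    1 + vecMulVec x y ∈ S := by
  have key := S.mul_mem (S.mul_mem h₁ h₂) (S.mul_mem h₃ h₄)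
  have e₁ : (1 + vecMulVec x e) * (1 + vecMulVec e y) =
      1 + vecMulVec x e + vecMulVec e y + vecMulVec x y := by
    rw [mul_add, add_mul, add_mul, vecMulVec_mul_vecMulVec, hee]
    simp only [one_smul, one_mul, mul_one]
    abel
  have e₂ : (1 + vecMulVec (-x) e) * (1 + vecMulVec e (-y)) =
      1 - vecMulVec x e - vecMulVec e y + vecMulVec x y := by
    rw [mul_add, add_mul, add_mul, vecMulVec_mul_vecMulVec, hee]
    simp only [one_smul, one_mul, mul_one, neg_vecMulVec, vecMulVec_neg, neg_neg]
    abel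
  rw [e₁, e₂] at key
  convert key using 1
  simp only [mul_add, mul_sub, add_mul, vecMulVec_mul_vecMulVec, hee, hex, hye, hyx, one_mul,
    mul_one, zero_smul, one_smul, vecMulVec_zero]
  abel

lemma one_add_vecMulVec_single_single {ι R : Type*} [DecidableEq ι] [CommRing R]
    (i j : ι) (a b : R) :
    1 + vecMulVec (Pi.single i a) (Pi.single j b) = Matrix.transvection i j (a * b) := by
  rw [Matrix.transvection]
  congr 1
  ext k l
  simp only [vecMulVec_apply, Matrix.single_apply, Pi.single_apply]
  by_cases hk : i = k <;> by_cases hl : j = l <;> simp [hk, hl, eq_comm]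

lemma eq_sum_single (x : ι → R) : x = ∑ i, Pi.single i (x i) :=
  (Finset.univ_sum_single x).symm

lemma one_add_vecMulVec_single_right_mem {S : Submonoid (Matrix ι ι R)} {m : R}
    (k : ι) (hS : ∀ i, i ≠ k → ∀ s, Matrix.transvection i k (m * s) ∈ S)
    (x : ι → R) (hx : x k = 0) :
    1 + vecMulVec (m • x) (Pi.single k 1) ∈ S := by
  suffices m • x ∈ leftVectors S (Pi.single k 1) from this.2
  rw [eq_sum_single (m • x)]
  refine sum_mem fun i _ => ?_
  by_cases hik : i = k
  · subst hik
    simp [hx, zero_mem]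
  · refine ⟨by simp [Ne.symm hik], ?_⟩
    rw [one_add_vecMulVec_single_single]
    simpa using hS i hik (x i)

lemma one_add_vecMulVec_single_left_mem {S : Submonoid (Matrix ι ι R)} {m : R}
    (k : ι) (hS : ∀ j, j ≠ k → ∀ s, Matrix.transvection k j (m * s) ∈ S)
    (y : ι → R) (hy : y k = 0) :
    1 + vecMulVec (Pi.single k 1) (m • y) ∈ S := by
  suffices m • y ∈ rightVectors S (Pi.single k 1) from this.2
  rw [eq_sum_single (m • y)]
  refine sum_mem fun i _ => ?_
  by_cases hik : i = k
  · subst hik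
    simp [hy, zero_mem]
  · refine ⟨by simp [hik], ?_⟩
    rw [one_add_vecMulVec_single_single]
    simpa using hS i hik (y i)

lemma smul_koszul_mem_rightVectors {S : Submonoid (Matrix ι ι R)} {m : R}
    (hι : ∀ i j : ι, ∃ k, k ≠ i ∧ k ≠ j)
    (hS : ∀ i j, i ≠ j → ∀ s, Matrix.transvection i j (m * s) ∈ S)
    (v : ι → R) (i j : ι) (c : R) :
    (m ^ 2 * c) • (Pi.single j (v i) - Pi.single i (v j)) ∈ rightVectors S v := by
  rcases eq_or_ne i j with rfl | hij
  · simp [zero_mem]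
  obtain ⟨k, hki, hkj⟩ := hι i j
  set w : ι → R := Pi.single j (v i) - Pi.single i (v j) with hw
  have hwv : w ⬝ᵥ v = 0 := by simp [hw, sub_dotProduct, mul_comm]
  have hwk : w k = 0 := by simp [hw, hki, hkj]
  refine ⟨by rw [smul_dotProduct, hwv, smul_zero], ?_⟩
  suffices v ∈ leftVectors S ((m ^ 2 * c) • w) from this.2
  set v' : ι → R := Pi.single i (v i) + Pi.single j (v j) with hv'
  have hwv' : w ⬝ᵥ v' = 0 := by
    simp [hw, hv', dotProduct_add, hij, hij.symm, mul_comm]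
  have hv'k : v' k = 0 := by simp [hv', hki, hkj]
  have h₁ : v' ∈ leftVectors S ((m ^ 2 * c) • w) := by
    refine ⟨by rw [smul_dotProduct, hwv', smul_zero], ?_⟩
    have : vecMulVec v' ((m ^ 2 * c) • w) = vecMulVec (m • c • v') (m • w) := by
      simp only [vecMulVec_smul, smul_vecMulVec, smul_smul]
      congr 1
      ring
    rw [this]
    refine one_add_vecMulVec_mem_of_commutator (e := Pi.single k 1) (by simp) (by simp [hv'k])
      (by simp [hwk]) (by simp [hwv']) ?_ ?_ ?_ ?_
    · exact one_add_vecMulVec_single_right_mem k (fun i hi => hS i k hi) _ (by simp [hv'k])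
    · exact one_add_vecMulVec_single_left_mem k (fun j hj => hS k j hj.symm) _ hwk
    · rw [← smul_neg]
      exact one_add_vecMulVec_single_right_mem k (fun i hi => hS i k hi) _ (by simp [hv'k])
    · rw [← smul_neg]
      exact one_add_vecMulVec_single_left_mem k (fun j hj => hS k j hj.symm) _ (by simp [hwk])
  have h₂ : v - v' ∈ leftVectors S ((m ^ 2 * c) • w) := by
    rw [eq_sum_single (v - v')]
    refine sum_mem fun l _ => ?_
    by_cases hli : l = i
    · simp [hv', hli, hij, zero_mem]
    by_cases hlj : l = j
    · simp [hv', hlj, hij.symm, zero_mem]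
    have hwl : w l = 0 := by simp [hw, hli, hlj]
    refine ⟨by simp [hwl], ?_⟩
    have hvl : (v - v') l = v l := by simp [hv', hli, hlj]
    rw [hvl]
    have : vecMulVec (Pi.single l (v l)) ((m ^ 2 * c) • w) =
        vecMulVec (Pi.single l 1) (m • (m * c * v l) • w) := by
      rw [← mul_one (v l), ← smul_eq_mul, Pi.single_smul]
      simp only [vecMulVec_smul, smul_vecMulVec, smul_smul]
      congr 1
      simp only [smul_eq_mul]
      ring
    rw [this]
    exact one_add_vecMulVec_single_left_mem l (fun j hj => hS l j hj.symm) _ (by simp [hwl])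
  simpa using add_mem h₁ h₂

/-- A submonoid of matrices containing all elementary matrices with entries in `m R` contains
`1 + m² v wᵀ` for every unimodular vector `v` and every `w` orthogonal to it. -/
theorem one_add_vecMulVec_mem {S : Submonoid (Matrix ι ι R)} {m : R}
    (hι : ∀ i j : ι, ∃ k, k ≠ i ∧ k ≠ j)
    (hS : ∀ i j, i ≠ j → ∀ s, Matrix.transvection i j (m * s) ∈ S)
    {u v w : ι → R} (huv : u ⬝ᵥ v = 1) (hwv : w ⬝ᵥ v = 0) :
    1 + vecMulVec v (m ^ 2 • w) ∈ S := by
  suffices m ^ 2 • w ∈ rightVectors S v from this.2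
  have hsum : m ^ 2 • w = ∑ k, ∑ l, (m ^ 2 * (u k * w l)) •
      ((Pi.single l (v k) : ι → R) - Pi.single k (v l)) := by
    ext a
    simp only [Finset.sum_apply, Pi.smul_apply, Pi.sub_apply, smul_eq_mul, mul_sub,
      Finset.sum_sub_distrib, Pi.single_apply, mul_ite, mul_zero, Finset.sum_ite_eq,
      Finset.mem_univ, if_true]
    rw [Finset.sum_comm (γ := ι) (f := fun x y => if a = x then m ^ 2 * (u x * w y) * v y else 0)]
    simp only [Finset.sum_ite_eq, Finset.mem_univ, if_true]
    have h₁ : ∑ x, m ^ 2 * (u x * w a) * v x = m ^ 2 * w a * (u ⬝ᵥ v) := by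
      rw [dotProduct, Finset.mul_sum]
      exact Finset.sum_congr rfl fun _ _ => by ring
    have h₂ : ∑ x, m ^ 2 * (u a * w x) * v x = m ^ 2 * u a * (w ⬝ᵥ v) := by
      rw [dotProduct, Finset.mul_sum]
      exact Finset.sum_congr rfl fun _ _ => by ring
    rw [h₁, h₂, huv, hwv]
    ring
  rw [hsum]
  exact sum_mem fun k _ => sum_mem fun l _ => smul_koszul_mem_rightVectors hι hS v k l _


/-- Over any commutative ring and in degree at least three, conjugates of elementary matrices
with entries in `m² R` lie in every subgroup containing those with entries in `m R`. -/
theorem conj_transvection_mem {H : Subgroup (SpecialLinearGroup ι R)} {m : R}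
    (hι : ∀ i j : ι, ∃ k, k ≠ i ∧ k ≠ j)
    (hH : ∀ i j, (hij : i ≠ j) → ∀ s, SpecialLinearGroup.transvection hij (m * s) ∈ H)
    (g : SpecialLinearGroup ι R) {i j : ι} (hij : i ≠ j) (s : R) :
    g * SpecialLinearGroup.transvection hij (m ^ 2 * s) * g⁻¹ ∈ H := by
  have hg : (↑g⁻¹ : Matrix ι ι R) * (g : Matrix ι ι R) = 1 := by
    rw [← SpecialLinearGroup.coe_mul, inv_mul_cancel, SpecialLinearGroup.coe_one]
  have hg' : (g : Matrix ι ι R) * (↑g⁻¹ : Matrix ι ι R) = 1 := by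
    rw [← SpecialLinearGroup.coe_mul, mul_inv_cancel, SpecialLinearGroup.coe_one]
  have hdot (a b : ι → R) :
      (a ᵥ* (↑g⁻¹ : Matrix ι ι R)) ⬝ᵥ ((g : Matrix ι ι R) *ᵥ b) = a ⬝ᵥ b := by
    rw [← dotProduct_mulVec, mulVec_mulVec, hg, one_mulVec]
  have key := one_add_vecMulVec_mem (S := H.toSubmonoid.map SpecialLinearGroup.coeMonoidHom)
    (m := m) hι (fun i j hij s => ⟨_, hH i j hij s, rfl⟩)
    (u := Pi.single i 1 ᵥ* (↑g⁻¹ : Matrix ι ι R))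
    (v := (g : Matrix ι ι R) *ᵥ Pi.single i 1)
    (w := Pi.single j s ᵥ* (↑g⁻¹ : Matrix ι ι R))
    (by rw [hdot]; simp) (by rw [hdot]; simp [hij.symm])
  obtain ⟨a, ha, hav⟩ := key
  convert (show a ∈ H from ha) using 1
  refine Subtype.ext ?_
  refine Eq.trans ?_ hav.symm
  rw [SpecialLinearGroup.coe_mul, SpecialLinearGroup.coe_mul]
  have : ((SpecialLinearGroup.transvection hij (m ^ 2 * s) : SpecialLinearGroup ι R) :
      Matrix ι ι R) = 1 + vecMulVec (Pi.single i 1) (m ^ 2 • Pi.single j s) := by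
    rw [vecMulVec_smul, ← smul_vecMulVec, ← Pi.single_smul, one_add_vecMulVec_single_single]
    simp [SpecialLinearGroup.transvection]
  rw [this, mul_add, add_mul, mul_one, hg', mul_vecMulVec, vecMulVec_mul, smul_vecMul]

/-- Modulo a normal subgroup containing the elementary matrices congruent to `1`, the
principal congruence subgroup commutes with elementary matrices. -/
theorem commute_mk_transvection {R' : Type*} [CommRing R'] (f : R →+* R')
    (hι : ∀ i j : ι, ∃ k, k ≠ i ∧ k ≠ j)
    (N : Subgroup (SpecialLinearGroup ι R)) [N.Normal]
    (hN : ∀ i j, (hij : i ≠ j) → ∀ s, f s = 0 → SpecialLinearGroup.transvection hij s ∈ N)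
    {g : SpecialLinearGroup ι R} (hg : SpecialLinearGroup.map f g = 1)
    {i j : ι} (hij : i ≠ j) (s : R) :
    Commute (g : SpecialLinearGroup ι R ⧸ N) (SpecialLinearGroup.transvection hij s : _) := by
  let D : Subring (R × R) := (f.comp (RingHom.fst R R)).eqLocus (f.comp (RingHom.snd R R))
  let p₁ : D →+* R := (RingHom.fst R R).comp D.subtype
  let p₂ : D →+* R := (RingHom.snd R R).comp D.subtype
  have hD (x : D) : f (p₁ x) = f (p₂ x) := x.2
  have hDext (x y : D) (h₁ : p₁ x = p₁ y) (h₂ : p₂ x = p₂ y) : x = y :=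
    Subtype.ext (Prod.ext h₁ h₂)
  let H : Subgroup (SpecialLinearGroup ι D) :=
    ((QuotientGroup.mk' N).comp (SpecialLinearGroup.map p₁)).eqLocus
      ((QuotientGroup.mk' N).comp (SpecialLinearGroup.map p₂))
  have map_transvection (p : D →+* R) {k l : ι} (hkl : k ≠ l) (x : D) :
      SpecialLinearGroup.map p (SpecialLinearGroup.transvection hkl x) =
        SpecialLinearGroup.transvection hkl (p x) := by
    ext a b
    change p ((1 + single k l x : Matrix ι ι D) a b) = (1 + single k l (p x) : Matrix ι ι R) a b
    simp only [Matrix.add_apply, Matrix.one_apply, Matrix.single_apply, map_add, apply_ite p,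
      map_one, map_zero]
  have hH : ∀ k l, (hkl : k ≠ l) → ∀ x : D, SpecialLinearGroup.transvection hkl (1 * x) ∈ H := by
    intro k l hkl x
    change (QuotientGroup.mk' N) _ = (QuotientGroup.mk' N) _
    rw [map_transvection, map_transvection, one_mul]
    refine QuotientGroup.eq.2 ?_
    rw [SpecialLinearGroup.transvection_inv, ← SpecialLinearGroup.transvection_add]
    exact hN k l hkl _ (by rw [map_add, map_neg, hD, neg_add_cancel])
  let M : Matrix ι ι D := Matrix.of fun a b => ⟨(g a b, (1 : Matrix ι ι R) a b), by
    have := congrArg (fun A : SpecialLinearGroup ι R' => A a b) hg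
    change f (g a b) = f _
    simpa [Matrix.one_apply, apply_ite f] using this⟩
  have hM₁ : p₁.mapMatrix M = g := rfl
  have hM₂ : p₂.mapMatrix M = 1 := rfl
  have hM : M.det = 1 := by
    apply hDext
    · rw [RingHom.map_det, hM₁, map_one, g.det_coe]
    · rw [RingHom.map_det, hM₂, map_one, det_one]
  let G : SpecialLinearGroup ι D := ⟨M, hM⟩
  have hG₁ : SpecialLinearGroup.map p₁ G = g := rfl
  have hG₂ : SpecialLinearGroup.map p₂ G = 1 := rfl
  let x : D := ⟨(s, s), rfl⟩
  have hx₁ : p₁ x = s := rfl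
  have hx₂ : p₂ x = s := rfl
  have key := conj_transvection_mem hι hH G hij x
  change (QuotientGroup.mk' N) (SpecialLinearGroup.map p₁ _) =
    (QuotientGroup.mk' N) (SpecialLinearGroup.map p₂ _) at key
  rw [one_pow, one_mul] at key
  simp only [map_mul, map_inv, hG₁, hG₂, map_transvection, hx₁, hx₂, one_mul, inv_one,
    mul_one] at key
  exact mul_inv_eq_iff_eq_mul.1 key

end ElementaryMatrices

section Euclid

variable {ι : Type*} [Fintype ι] [DecidableEq ι]

lemma transvection_smul {R : Type*} [CommRing R] {i j : ι} (hij : i ≠ j) (b : R) (v : ι → R) :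
    SpecialLinearGroup.transvection hij b • v = v + Pi.single i (b * v j) := by
  rw [SpecialLinearGroup.smul_def, SpecialLinearGroup.transvection_coe]
  simp [add_mulVec, single_mulVec_eq, ← Pi.single_smul]

lemma SpecialLinearGroup.commutatorElement_transvection {R : Type*} [CommRing R] {i k j : ι}
    (hik : i ≠ k) (hkj : k ≠ j) (hij : i ≠ j) (s : R) :
    ⁅SpecialLinearGroup.transvection hik s, SpecialLinearGroup.transvection hkj (1 : R)⁆ =
      SpecialLinearGroup.transvection hij s := by
  rw [commutatorElement_def, SpecialLinearGroup.transvection_inv,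
    SpecialLinearGroup.transvection_inv]
  refine Subtype.ext ?_
  simp only [SpecialLinearGroup.coe_mul, SpecialLinearGroup.transvection_coe, mul_add, add_mul,
    mul_one, one_mul, single_mul_single_same, single_mul_single_of_ne _ _ _ _ hik.symm,
    single_mul_single_of_ne _ _ _ _ hkj.symm, single_mul_single_of_ne _ _ _ _ hij.symm,
    add_zero, mul_neg]
  simp only [← single_neg]
  abel

/-- If a subgroup contains all elementary matrices supported in column `k`, it can clear a column
whose `k`-th entry is `1`. -/
lemma exists_smul_eq_single_of_apply_eq_one {R : Type*} [CommRing R]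
    {K : Subgroup (SpecialLinearGroup ι R)} {k : ι}
    (hK : ∀ i, (hik : i ≠ k) → ∀ s, SpecialLinearGroup.transvection hik s ∈ K)
    (v : ι → R) (hv : v k = 1) : ∃ e ∈ K, e • v = Pi.single k 1 := by
  obtain ⟨e, he, hev⟩ := one_add_vecMulVec_single_right_mem (m := (1 : R))
    (S := K.toSubmonoid.map SpecialLinearGroup.coeMonoidHom) k
    (fun i hi s => ⟨_, hK i hi _, rfl⟩) (Pi.single k 1 - v) (by simp [hv])
  refine ⟨e, he, ?_⟩
  rw [SpecialLinearGroup.smul_def]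
  change (SpecialLinearGroup.coeMonoidHom e) • v = _
  rw [hev]
  simp [add_mulVec, vecMulVec_mulVec, hv]

lemma exists_smul_eq_single {K : Subgroup (SpecialLinearGroup ι ℤ)} {F : Set ι}
    (hK : ∀ i j, (hij : i ≠ j) → j ∉ F → ∀ s, SpecialLinearGroup.transvection hij s ∈ K)
    {k p : ι} (hk : k ∉ F) (hp : p ∉ F) (hpk : p ≠ k)
    (u v : ι → ℤ) (hu : ∀ j ∈ F, u j = 0) (huv : u ⬝ᵥ v = 1) :
    ∃ e ∈ K, e • v = Pi.single k 1 := by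
  classical
  have step (e) (he : e ∈ K) (v : ι → ℤ) (h : ∃ e' ∈ K, e' • e • v = Pi.single k 1) :
      ∃ e' ∈ K, e' • v = Pi.single k 1 := by
    obtain ⟨e', he', h⟩ := h
    exact ⟨e' * e, K.mul_mem he' he, by rw [mul_smul, h]⟩
  have of_eq_one (v : ι → ℤ) (hv : v k = 1) : ∃ e ∈ K, e • v = Pi.single k 1 :=
    exists_smul_eq_single_of_apply_eq_one (fun i hik s => hK i k hik hk s) v hv
  have of_unit (v : ι → ℤ) (l : ι) (hl : l ∉ F) (hlk : l ≠ k) (hv : v l * v l = 1) :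
      ∃ e ∈ K, e • v = Pi.single k 1 := by
    refine step _ (hK k l hlk.symm hl ((1 - v k) * v l)) v (of_eq_one _ ?_)
    rw [transvection_smul, mul_assoc, hv]
    simp
  induction hμ : ∑ i with i ∉ F, (v i).natAbs using Nat.strong_induction_on generalizing u v with
  | _ μ ih =>
  subst hμ
  by_cases hpair : ∃ i j, i ≠ j ∧ i ∉ F ∧ j ∉ F ∧ v j ≠ 0 ∧ (v j).natAbs ≤ (v i).natAbs
  · obtain ⟨i, j, hij, hi, hj, hvj, hle⟩ := hpair
    set b : ℤ := -(v i / v j) with hb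
    have hvi : v i + b * v j = v i % v j := by
      rw [hb, Int.emod_def]; ring
    refine step _ (hK i j hij hj b) v ?_
    rw [transvection_smul]
    refine ih _ ?_ (u - Pi.single j (b * u i)) _ (fun l hl => ?_) ?_ rfl
    · refine Finset.sum_lt_sum (fun l _ => ?_) ⟨i, by simpa using hi, ?_⟩
      · by_cases hl : l = i
        · subst hl
          simp only [Pi.add_apply, Pi.single_eq_same, hvi]
          have := Int.emod_nonneg (v l) hvj
          have := Int.emod_lt (v l) hvj
          omega
        · simp [hl]
      · simp only [Pi.add_apply, Pi.single_eq_same, hvi]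
        have := Int.emod_nonneg (v i) hvj
        have := Int.emod_lt (v i) hvj
        omega
    · have : l ≠ j := by rintro rfl; exact hj hl
      simp [this, hu l hl]
    · simp only [sub_dotProduct, dotProduct_add, huv, dotProduct_single, single_dotProduct,
        Pi.sub_apply, Pi.single_eq_of_ne hij]
      ring
  · push Not at hpair
    have hne : ∃ l, l ∉ F ∧ v l ≠ 0 := by
      by_contra! hcon
      have : u ⬝ᵥ v = 0 := Finset.sum_eq_zero fun l _ => by
        by_cases hl : l ∈ F
        · simp [hu l hl]
        · simp [hcon l hl]
      omega
    obtain ⟨l, hl, hvl⟩ := hne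
    have hzero (a : ι) (ha : a ∉ F) (hal : a ≠ l) : v a = 0 := by
      by_contra hva
      have h₁ := hpair a l hal ha hl hvl
      have h₂ := hpair l a hal.symm hl ha hva
      omega
    have hunit : v l * v l = 1 := by
      have h : u l * v l = 1 := by
        rw [← huv, dotProduct, Finset.sum_eq_single l]
        · intro a _ hal
          by_cases ha : a ∈ F
          · simp [hu a ha]
          · simp [hzero a ha hal]
        · simp
      rcases Int.isUnit_iff.1 (IsUnit.of_mul_eq_one_right _ h) with h | h <;> rw [h] <;> rfl
    by_cases hlk : l = k
    · subst hlk
      refine step _ (hK p l hpk hl (v l)) v (of_unit _ p hp hpk ?_)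
      rw [transvection_smul, hunit]
      simp [hzero p hp hpk]
    · exact of_unit v l hl hlk hunit

/-- `SL(n, ℤ)` is generated by elementary matrices. -/
theorem eq_top_of_transvection_mem {n : ℕ} {E : Subgroup (SpecialLinearGroup (Fin n) ℤ)}
    (hE : ∀ i j, (hij : i ≠ j) → ∀ s, SpecialLinearGroup.transvection hij s ∈ E) : E = ⊤ := by
  have eq_one (g : SpecialLinearGroup (Fin n) ℤ)
      (hg : ∀ j, g • (Pi.single j 1 : Fin n → ℤ) = Pi.single j 1) : g = 1 := by
    ext i j
    have := congrFun (hg j) i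
    simpa [SpecialLinearGroup.smul_def, Matrix.one_apply, Pi.single_apply] using this
  suffices ∀ r ≤ n, ∀ g : SpecialLinearGroup (Fin n) ℤ,
      (∀ j : Fin n, j.val + r < n → g • (Pi.single j 1 : Fin n → ℤ) = Pi.single j 1) → g ∈ E from
    eq_top_iff.2 fun g _ => this n le_rfl g fun j hj => by omega
  intro r
  induction r with
  | zero =>
    intro _ g hg
    rw [eq_one g fun j => hg j (by simp)]
    exact E.one_mem
  | succ r ih =>
    intro hr g hg
    let k : Fin n := ⟨n - (r + 1), by omega⟩
    let F : Set (Fin n) := {j | j < k}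
    have hF (j : Fin n) : j ∈ F ↔ j.val + (r + 1) < n := by
      simp only [F, Set.mem_ofPred_eq, Fin.lt_def, k]; omega
    let K : Subgroup (SpecialLinearGroup (Fin n) ℤ) :=
      E ⊓ ⨅ j ∈ F, MulAction.stabilizer _ (Pi.single j 1 : Fin n → ℤ)
    have mem_K (e) : e ∈ K ↔
        e ∈ E ∧ ∀ j ∈ F, e • (Pi.single j 1 : Fin n → ℤ) = Pi.single j 1 := by
      simp [K, Subgroup.mem_iInf]
    have hK : ∀ i j, (hij : i ≠ j) → j ∉ F → ∀ s, SpecialLinearGroup.transvection hij s ∈ K := by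
      refine fun i j hij hj s => (mem_K _).2 ⟨hE i j hij s, fun l hl => ?_⟩
      have : j ≠ l := by rintro rfl; exact hj hl
      simp [transvection_smul, this]
    have hkF : k ∉ F := lt_irrefl k
    have entry (i j : Fin n) (hj : j ∈ F) : g i j = if i = j then 1 else 0 := by
      have := congrFun (hg j ((hF j).1 hj)) i
      simpa [SpecialLinearGroup.smul_def, Pi.single_apply] using this
    obtain ⟨e, he, hev⟩ : ∃ e ∈ K, e • g • (Pi.single k 1 : Fin n → ℤ) = Pi.single k 1 := by
      rcases Nat.eq_zero_or_pos r with rfl | hr₀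
      · have mem_F (j : Fin n) (hj : j ≠ k) : j ∈ F := by
          have : j.val ≠ n - 1 := fun h => hj (Fin.ext h)
          rw [hF]; omega
        refine exists_smul_eq_single_of_apply_eq_one (fun i hik s => hK i k hik hkF s) _ ?_
        have hdet := g.det_coe
        rw [Matrix.det_of_isUpperTriangular, Finset.prod_eq_single k] at hdet
        · simpa [SpecialLinearGroup.smul_def] using hdet
        · intro j _ hj
          simpa using entry j j (mem_F j hj)
        · simp
        · intro i j hij
          have hj : j ∈ F := mem_F j (by
            rintro rfl
            simp only [id, Fin.lt_def, k] at hij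
            omega)
          simpa [(show j < i from hij).ne'] using entry i j hj
      · let p : Fin n := ⟨n - r, by omega⟩
        have hpk : p ≠ k := fun h => by
          have := congrArg Fin.val h
          simp only [p, k] at this
          omega
        have hpF : p ∉ F := by rw [hF]; simp only [p]; omega
        refine exists_smul_eq_single hK hkF hpF hpk (fun j => (↑g⁻¹ : Matrix _ _ ℤ) k j) _
          (fun j hj => ?_) ?_
        · have : g⁻¹ • (Pi.single j 1 : Fin n → ℤ) = Pi.single j 1 :=
            inv_smul_eq_iff.2 (hg j ((hF j).1 hj)).symm
          have hjk : k ≠ j := by rintro rfl; exact hkF hj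
          simpa [SpecialLinearGroup.smul_def, hjk, -SpecialLinearGroup.coe_inv]
            using congrFun this k
        · exact (congrFun (inv_smul_smul g (Pi.single k 1 : Fin n → ℤ)) k).trans (by simp)
    obtain ⟨heE, heF⟩ := (mem_K e).1 he
    refine (E.mul_mem_cancel_left heE).1 (ih (by omega) _ fun j hj => ?_)
    rw [mul_smul]
    by_cases hjk : j = k
    · rw [hjk, hev]
    · have : j.val ≠ n - (r + 1) := fun h => hjk (Fin.ext h)
      have hj' : j.val + (r + 1) < n := by omega
      rw [hg j hj', heF j ((hF j).2 hj')]

end Euclid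

end Matrix

open Matrix

/-- A perfect group whose centre has finite index is finite. -/
theorem finite_of_perfect_of_finiteIndex_center {Q : Type*} [Group Q]
    (hperf : commutator Q = ⊤) [(Subgroup.center Q).FiniteIndex] : Finite Q := by
  have : Finite (commutatorSet Q) := by
    have mul_left {z : Q} (hz : z ∈ Subgroup.center Q) (a b : Q) :
        a * z * b * (a * z)⁻¹ * b⁻¹ = a * b * a⁻¹ * b⁻¹ := by
      rw [mul_assoc a z b, ← Subgroup.mem_center_iff.1 hz b]
      group
    have mul_right {z : Q} (hz : z ∈ Subgroup.center Q) (a b : Q) :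
        a * (b * z) * a⁻¹ * (b * z)⁻¹ = a * b * a⁻¹ * b⁻¹ := by
      rw [← mul_assoc a b z, mul_assoc (a * b) z a⁻¹, ← Subgroup.mem_center_iff.1 hz a⁻¹]
      group
    let c : (Q ⧸ Subgroup.center Q) × (Q ⧸ Subgroup.center Q) → Q :=
      fun x => x.1.out * x.2.out * x.1.out⁻¹ * x.2.out⁻¹
    refine (Set.finite_range c).subset ?_
    rintro _ ⟨a, b, rfl⟩
    refine ⟨(a, b), ?_⟩
    obtain ⟨z, hz⟩ := QuotientGroup.mk_out_eq_mul (Subgroup.center Q) a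
    obtain ⟨y, hy⟩ := QuotientGroup.mk_out_eq_mul (Subgroup.center Q) b
    simp only [c, hz, hy, mul_left z.2, mul_right y.2]
    rfl
  have : Finite (⊤ : Subgroup Q) := hperf ▸ inferInstanceAs (Finite (commutator Q))
  exact Finite.of_equiv _ Subgroup.topEquiv.toEquiv

/-- **Theorem.** Let `n ≥ 3` and `m ≥ 1`. If a subgroup `Λ` of `SL(n,ℤ)` contains
`e_{i,j}(m)` for all `1 ≤ i ≠ j ≤ n`, then `Λ` has finite index in `SL(n,ℤ)`. -/
theorem stmt18 (n : ℕ) (hn : 3 ≤ n) (m : ℤ) (hm : 1 ≤ m)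
    (Λ : Subgroup (Matrix.SpecialLinearGroup (Fin n) ℤ))
    (h : ∀ i j : Fin n, (hij : i ≠ j) → Elem i j hij m ∈ Λ) :
    Λ.FiniteIndex := by
  have hι (i j : Fin n) : ∃ k, k ≠ i ∧ k ≠ j := by
    obtain ⟨k, hk⟩ := Finset.exists_mem_notMem_of_card_lt_card (s := {i, j}) (t := Finset.univ)
      (by rw [Finset.card_univ, Fintype.card_fin]; exact Finset.card_le_two.trans_lt hn)
    exact ⟨k, by simpa using hk⟩
  have hΛ : ∀ i j : Fin n, (hij : i ≠ j) → ∀ s,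
      Matrix.SpecialLinearGroup.transvection hij (m * s) ∈ Λ := by
    intro i j hij s
    let φ : Multiplicative ℤ →* Matrix.SpecialLinearGroup (Fin n) ℤ :=
      { toFun := fun a => Matrix.SpecialLinearGroup.transvection hij a.toAdd
        map_one' := Matrix.SpecialLinearGroup.transvection_coeff_zero hij
        map_mul' := fun a b => Matrix.SpecialLinearGroup.transvection_add hij _ _ }
    have : φ (Multiplicative.ofAdd m ^ s) ∈ Λ := by
      rw [map_zpow]
      exact Λ.zpow_mem (h i j hij) s
    rwa [← ofAdd_zsmul, smul_eq_mul, mul_comm] at this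
  let N : Subgroup (Matrix.SpecialLinearGroup (Fin n) ℤ) := Subgroup.normalClosure
    {g | ∃ i j, ∃ hij : i ≠ j, ∃ s, Matrix.SpecialLinearGroup.transvection hij (m ^ 2 * s) = g}
  have hNΛ : N ≤ Λ := by
    refine (Subgroup.closure_le _).2 ?_
    intro x hx
    obtain ⟨_, ⟨i, j, hij, s, rfl⟩, hx⟩ := Group.mem_conjugatesOfSet_iff.1 hx
    obtain ⟨g, rfl⟩ := isConj_iff.1 hx
    exact conj_transvection_mem hι hΛ g hij s
  let q : ℕ := (m ^ 2).toNat
  have hq : (q : ℤ) = m ^ 2 := Int.toNat_of_nonneg (sq_nonneg m)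
  have : NeZero q := ⟨fun h0 => by rw [h0] at hq; push_cast at hq; nlinarith⟩
  let f : ℤ →+* ZMod q := Int.castRingHom (ZMod q)
  have hN : ∀ i j, (hij : i ≠ j) → ∀ s, f s = 0 →
      Matrix.SpecialLinearGroup.transvection hij s ∈ N := by
    intro i j hij s hs
    obtain ⟨t, rfl⟩ := (ZMod.intCast_zmod_eq_zero_iff_dvd s q).1 hs
    rw [hq]
    exact Subgroup.subset_normalClosure ⟨i, j, hij, t, rfl⟩
  let π := QuotientGroup.mk' N
  have hπ : Function.Surjective π := QuotientGroup.mk'_surjective N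
  have hcenter : (Matrix.SpecialLinearGroup.map f).ker ≤ (Subgroup.center _).comap π := by
    intro g hg
    have htop : (Subgroup.centralizer {π g}).comap π = ⊤ :=
      eq_top_of_transvection_mem fun i j hij s =>
        Subgroup.mem_centralizer_singleton_iff.2 (commute_mk_transvection f hι N hN hg hij s).symm
    refine Subgroup.mem_center_iff.2 fun x => ?_
    obtain ⟨y, rfl⟩ := hπ x
    exact Subgroup.mem_centralizer_singleton_iff.1
      (Subgroup.mem_comap.1 (htop.symm ▸ Subgroup.mem_top y))
  have hperf : commutator (Matrix.SpecialLinearGroup (Fin n) ℤ ⧸ N) = ⊤ := by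
    have htop : commutator (Matrix.SpecialLinearGroup (Fin n) ℤ) = ⊤ := by
      refine eq_top_of_transvection_mem fun i j hij s => ?_
      obtain ⟨k, hki, hkj⟩ := hι i j
      rw [← Matrix.SpecialLinearGroup.commutatorElement_transvection hki.symm hkj hij]
      exact Subgroup.commutator_mem_commutator (Subgroup.mem_top _) (Subgroup.mem_top _)
    have hmap := Subgroup.map_commutator (⊤ : Subgroup (Matrix.SpecialLinearGroup (Fin n) ℤ)) ⊤ π
    rw [← commutator_def, htop, Subgroup.map_top_of_surjective π hπ] at hmap
    rw [commutator_def, ← hmap]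
  have : (Matrix.SpecialLinearGroup.map (n := Fin n) f).ker.FiniteIndex := Subgroup.finiteIndex_ker _
  have : (Subgroup.center (Matrix.SpecialLinearGroup (Fin n) ℤ ⧸ N)).FiniteIndex := by
    have := Subgroup.finiteIndex_of_le hcenter
    refine ⟨?_⟩
    rw [← Subgroup.index_comap_of_surjective _ hπ]
    exact this.index_ne_zero
  have := finite_of_perfect_of_finiteIndex_center hperf
  have : N.FiniteIndex := Subgroup.finiteIndex_of_finite_quotient
  exact Subgroup.finiteIndex_of_le hNΛ
end
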